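/- arXiv:0806.4263 — 4 statements merged into one kernel-verified Lean document; each statement's English description precedes it below -/
import Mathlib

section
/- Let Y : Ω → ℝ^k and Z, Z' : Ω → ℝ^l be random vectors on a probability space (Ω, F, P) such that Z' is independent of Y and Z' has the same distribution as Z. Let g : ℝ^k → ℝ be measurable with |g(x)| ≤ G for all x, and let h : ℝ^l → ℝ be measurable and L-Lipschitz with respect to the l¹-norm. Assume h(Z) is integrable and E|Z_i − Z'_i| < ∞ for each i = 1,…,l. Then |cov(g(Y), h(Z))| ≤ G · L · Σ_{i=1}^l E|Z_i − Z'_i|. -/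
open MeasureTheory ProbabilityTheory

/-- **Lemma 2.1 (coupling form).** If `Z'` is an independent copy of `Z`, independent of the
"past" `Y`, then the covariance between a bounded measurable function `g` of `Y` and an
`L`-Lipschitz (w.r.t. the `l¹`-norm) function `h` of `Z` is bounded by
`G * L * ∑ i, E|Z i − Z' i|`. -/
theorem covariance_le_of_indep_copy
    {Ω : Type*} [MeasurableSpace Ω] (P : Measure Ω) [IsProbabilityMeasure P]
    {k l : ℕ} (Y : Ω → (Fin k → ℝ)) (Z Z' : Ω → (Fin l → ℝ))
    (hY : Measurable Y) (hZ : Measurable Z) (hZ' : Measurable Z')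
    (hindep : IndepFun Y Z' P)
    (hcopy : IdentDistrib Z' Z P P)
    (g : (Fin k → ℝ) → ℝ) (h : (Fin l → ℝ) → ℝ)
    (hg : Measurable g) (hh : Measurable h)
    (G : ℝ) (hgG : ∀ x, |g x| ≤ G)
    (L : ℝ) (hhL : ∀ x y, |h x - h y| ≤ L * ∑ i, |x i - y i|)
    (hhZ : Integrable (fun ω => h (Z ω)) P)
    (hZZ' : ∀ i, Integrable (fun ω => |Z ω i - Z' ω i|) P) :
    |(∫ ω, g (Y ω) * h (Z ω) ∂P)
        - (∫ ω, g (Y ω) ∂P) * (∫ ω, h (Z ω) ∂P)|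
      ≤ G * L * ∑ i, ∫ ω, |Z ω i - Z' ω i| ∂P := by
  have hcomp : IdentDistrib (fun ω => h (Z' ω)) (fun ω => h (Z ω)) P P := hcopy.comp hh
  have hhZ' : Integrable (fun ω => h (Z' ω)) P := hcomp.integrable_iff.mpr hhZ
  have hgY : AEStronglyMeasurable (fun ω => g (Y ω)) P := (hg.comp hY).aestronglyMeasurable
  have hbound : ∀ᵐ ω ∂P, ‖g (Y ω)‖ ≤ G := .of_forall fun ω => hgG (Y ω)
  have hprod : ∫ ω, g (Y ω) * h (Z' ω) ∂P = (∫ ω, g (Y ω) ∂P) * ∫ ω, h (Z ω) ∂P := by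
    rw [← hcomp.integral_eq]
    exact hindep.integral_fun_comp_mul_comp hY.aemeasurable hZ'.aemeasurable
      hg.aestronglyMeasurable hh.aestronglyMeasurable
  have hpointwise (ω : Ω) :
      ‖g (Y ω) * h (Z ω) - g (Y ω) * h (Z' ω)‖ ≤ G * L * ∑ i, |Z ω i - Z' ω i| := by
    rw [← mul_sub, norm_mul, mul_assoc]
    exact mul_le_mul (hgG _) (hhL _ _) (norm_nonneg _) ((abs_nonneg _).trans (hgG (Y ω)))
  rw [← hprod, ← integral_sub (hhZ.bdd_mul hgY hbound) (hhZ'.bdd_mul hgY hbound),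
    ← integral_finsetSum _ fun i _ => hZZ' i, ← integral_const_mul]
  exact norm_integral_le_of_norm_le
    ((integrable_finsetSum _ fun i _ => hZZ' i).const_mul _) (.of_forall hpointwise)
end

section
/- Let s ∈ ℤ, and let (ε_t)_{t∈ℤ} and (ε'_t)_{t∈ℤ} be real random variables on a common probability space such that every ε_t and every ε'_t has the same distribution as ε_0, E|ε_0| < ∞, and ε'_t = ε_t for all t > s. Let α : ℕ → ℝ satisfy |α_k| ≤ K ρ^k for all k ∈ ℕ, where K ≥ 0 and 0 ≤ ρ < 1, and define X_t = Σ_{k=0}^∞ α_k ε_{t−k} and X'_t = Σ_{k=0}^∞ α_k ε'_{t−k} (the series converge absolutely almost surely and in L¹). Then for any integers s ≤ t_1 ≤ t_2 ≤ … ≤ t_l, E[Σ_{j=1}^l |X_{t_j} − X'_{t_j}|] ≤ 2 l K ρ^{t_1 − s} E|ε_0| / (1 − ρ). -/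
open MeasureTheory ProbabilityTheory

/-- A series of random variables whose `L¹` norms are summable converges absolutely a.e. -/
lemma ae_summable_of_tsum_lintegral_enorm_ne_top {Ω : Type*} [MeasurableSpace Ω] {μ : Measure Ω}
    {f : ℕ → Ω → ℝ} (hf : ∀ k, Measurable (f k)) (hsum : ∑' k, ∫⁻ ω, ‖f k ω‖ₑ ∂μ ≠ ⊤) :
    ∀ᵐ ω ∂μ, Summable fun k => f k ω := by
  rw [← lintegral_tsum fun k => (hf k).enorm.aemeasurable] at hsum
  filter_upwards [ae_lt_top (Measurable.tsum fun k => (hf k).enorm) hsum] with ω hω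
  refine Summable.of_nnnorm ?_
  rw [← ENNReal.tsum_coe_ne_top_iff_summable]
  exact hω.ne

lemma tsum_ofReal_geometric_tail {C ρ : ℝ} (hC : 0 ≤ C) (hρ0 : 0 ≤ ρ) (hρ1 : ρ < 1) (n : ℕ) :
    ∑' k : ℕ, ENNReal.ofReal (C * ρ ^ (k + n)) = ENNReal.ofReal (C * ρ ^ n / (1 - ρ)) := by
  have h : HasSum (fun k : ℕ => C * ρ ^ (k + n)) (C * ρ ^ n / (1 - ρ)) := by
    have := (hasSum_geometric_of_lt_one hρ0 hρ1).mul_left (C * ρ ^ n)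
    simpa only [pow_add, mul_assoc, mul_comm, mul_left_comm, div_eq_mul_inv] using this
  rw [← ENNReal.ofReal_tsum_of_nonneg (fun k => by positivity) h.summable, h.tsum_eq]

lemma lintegral_enorm_const_mul_le_of_le {Ω : Type*} [MeasurableSpace Ω] {μ : Measure Ω}
    {η : ℤ → Ω → ℝ} (hη : ∀ t, Measurable (η t)) {m : ℝ}
    (hηm : ∀ t, ∫⁻ ω, ‖η t ω‖ₑ ∂μ ≤ ENNReal.ofReal m)
    {α : ℕ → ℝ} {K ρ : ℝ} (hK : 0 ≤ K) (hρ0 : 0 ≤ ρ)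
    (hα : ∀ k : ℕ, |α k| ≤ K * ρ ^ k) (u : ℤ) (k : ℕ) :
    ∫⁻ ω, ‖α k * η (u - k) ω‖ₑ ∂μ ≤ ENNReal.ofReal (K * m * ρ ^ k) := by
  simp only [enorm_mul]
  rw [lintegral_const_mul _ (hη _).enorm, mul_right_comm,
    ENNReal.ofReal_mul (by positivity), Real.enorm_eq_ofReal_abs]
  gcongr
  · exact hα k
  · exact hηm _

/-- A causal series with geometrically decaying coefficients and innovations bounded in `L¹`
converges a.e. -/
lemma ae_summable_causal_series {Ω : Type*} [MeasurableSpace Ω] {μ : Measure Ω}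
    {η : ℤ → Ω → ℝ} (hη : ∀ t, Measurable (η t)) {m : ℝ} (hm : 0 ≤ m)
    (hηm : ∀ t, ∫⁻ ω, ‖η t ω‖ₑ ∂μ ≤ ENNReal.ofReal m)
    {α : ℕ → ℝ} {K ρ : ℝ} (hK : 0 ≤ K) (hρ0 : 0 ≤ ρ) (hρ1 : ρ < 1)
    (hα : ∀ k : ℕ, |α k| ≤ K * ρ ^ k) (u : ℤ) :
    ∀ᵐ ω ∂μ, Summable fun k : ℕ => α k * η (u - k) ω := by
  refine ae_summable_of_tsum_lintegral_enorm_ne_top (fun k => (hη _).const_mul _) ?_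
  refine ne_top_of_le_ne_top ?_
    (ENNReal.tsum_le_tsum (lintegral_enorm_const_mul_le_of_le hη hηm hK hρ0 hα u))
  have := tsum_ofReal_geometric_tail (mul_nonneg hK hm) hρ0 hρ1 0
  simp only [add_zero] at this
  rw [this]
  exact ENNReal.ofReal_ne_top

/-- If two innovation sequences agree after time `s`, the values at time `u ≥ s + n` of the
associated causal series differ in `L¹` by at most a geometric tail of order `n`. -/
lemma lintegral_enorm_causal_series_sub_le {Ω : Type*} [MeasurableSpace Ω] {μ : Measure Ω}
    {ε ε' : ℤ → Ω → ℝ} (hε : ∀ t, Measurable (ε t)) (hε' : ∀ t, Measurable (ε' t))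
    {m : ℝ} (hm : 0 ≤ m)
    (hεm : ∀ t, ∫⁻ ω, ‖ε t ω‖ₑ ∂μ ≤ ENNReal.ofReal m)
    (hεm' : ∀ t, ∫⁻ ω, ‖ε' t ω‖ₑ ∂μ ≤ ENNReal.ofReal m)
    {s : ℤ} (heq : ∀ t : ℤ, s < t → ε' t = ε t)
    {α : ℕ → ℝ} {K ρ : ℝ} (hK : 0 ≤ K) (hρ0 : 0 ≤ ρ) (hρ1 : ρ < 1)
    (hα : ∀ k : ℕ, |α k| ≤ K * ρ ^ k) {u : ℤ} {n : ℕ} (hn : s + n ≤ u) :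
    ∫⁻ ω, ‖(∑' k : ℕ, α k * ε (u - k) ω) - ∑' k : ℕ, α k * ε' (u - k) ω‖ₑ ∂μ
      ≤ ENNReal.ofReal (K * (2 * m) * ρ ^ n / (1 - ρ)) := by
  let η : ℤ → Ω → ℝ := fun t ω => ε t ω - ε' t ω
  have hη : ∀ t, Measurable (η t) := fun t => (hε t).sub (hε' t)
  have hηm : ∀ t, ∫⁻ ω, ‖η t ω‖ₑ ∂μ ≤ ENNReal.ofReal (2 * m) := fun t => calc
    ∫⁻ ω, ‖η t ω‖ₑ ∂μ ≤ ∫⁻ ω, (‖ε t ω‖ₑ + ‖ε' t ω‖ₑ) ∂μ :=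
      lintegral_mono fun ω => enorm_sub_le
    _ = ∫⁻ ω, ‖ε t ω‖ₑ ∂μ + ∫⁻ ω, ‖ε' t ω‖ₑ ∂μ := lintegral_add_left (hε t).enorm _
    _ ≤ ENNReal.ofReal m + ENNReal.ofReal m := add_le_add (hεm t) (hεm' t)
    _ = ENNReal.ofReal (2 * m) := by rw [← ENNReal.ofReal_add hm hm, two_mul]
  have hbound : ∀ᵐ ω ∂μ,
      ‖(∑' k : ℕ, α k * ε (u - k) ω) - ∑' k : ℕ, α k * ε' (u - k) ω‖ₑ
        ≤ ∑' k : ℕ, ‖α (k + n) * η (u - (k + n : ℕ)) ω‖ₑ := by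
    filter_upwards [ae_summable_causal_series hε hm hεm hK hρ0 hρ1 hα u,
      ae_summable_causal_series hε' hm hεm' hK hρ0 hρ1 hα u] with ω h h'
    have hsub : Summable fun k : ℕ => α k * η (u - k) ω := by
      simpa only [η, mul_sub] using h.sub h'
    have hhead : ∑ k ∈ Finset.range n, α k * η (u - k) ω = 0 := by
      refine Finset.sum_eq_zero fun k hk => ?_
      have hk' := Finset.mem_range.1 hk
      simp [η, heq (u - k) (by omega)]
    rw [← h.tsum_sub h']
    simp only [← mul_sub]
    change ‖∑' k : ℕ, α k * η (u - k) ω‖ₑ ≤ _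
    rw [← hsub.sum_add_tsum_nat_add n, hhead, zero_add]
    exact enorm_tsum_le_tsum_enorm
  calc _ ≤ ∫⁻ ω, ∑' k : ℕ, ‖α (k + n) * η (u - (k + n : ℕ)) ω‖ₑ ∂μ := lintegral_mono_ae hbound
    _ = ∑' k : ℕ, ∫⁻ ω, ‖α (k + n) * η (u - (k + n : ℕ)) ω‖ₑ ∂μ :=
      lintegral_tsum fun k => ((hη _).const_mul _).enorm.aemeasurable
    _ ≤ ∑' k : ℕ, ENNReal.ofReal (K * (2 * m) * ρ ^ (k + n)) := ENNReal.tsum_le_tsum fun k =>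
      lintegral_enorm_const_mul_le_of_le hη hηm hK hρ0 hα u (k + n)
    _ = _ := tsum_ofReal_geometric_tail (by positivity) hρ0 hρ1 n

/-- **Lemma 2.2.** Two versions of a geometrically decaying causal linear process whose
innovations coincide after time `s` have values close in `L¹`, at geometric rate in the
time gap `t 0 − s`. -/
theorem linear_process_coupling_l1_bound
    {Ω : Type*} [MeasurableSpace Ω] (P : Measure Ω) [IsProbabilityMeasure P]
    (s : ℤ) (ε ε' : ℤ → Ω → ℝ)
    (hmeas : ∀ t, Measurable (ε t)) (hmeas' : ∀ t, Measurable (ε' t))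
    (hid : ∀ t, IdentDistrib (ε t) (ε 0) P P)
    (hid' : ∀ t, IdentDistrib (ε' t) (ε 0) P P)
    (hint : Integrable (ε 0) P)
    (heq : ∀ t : ℤ, s < t → ε' t = ε t)
    (α : ℕ → ℝ) (K ρ : ℝ) (hK : 0 ≤ K) (hρ0 : 0 ≤ ρ) (hρ1 : ρ < 1)
    (hα : ∀ k : ℕ, |α k| ≤ K * ρ ^ k)
    (X X' : ℤ → Ω → ℝ)
    (hX : ∀ t ω, X t ω = ∑' k : ℕ, α k * ε (t - k) ω)
    (hX' : ∀ t ω, X' t ω = ∑' k : ℕ, α k * ε' (t - k) ω)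
    (l : ℕ) (hl : 0 < l) (t : Fin l → ℤ) (ht : Monotone t)
    (hst : s ≤ t ⟨0, hl⟩) :
    ∫ ω, ∑ j, |X (t j) ω - X' (t j) ω| ∂P
      ≤ 2 * l * K * ρ ^ (t ⟨0, hl⟩ - s).toNat * (∫ ω, |ε 0 ω| ∂P) / (1 - ρ) := by
  set m := ∫ ω, |ε 0 ω| ∂P
  set n := (t ⟨0, hl⟩ - s).toNat with hn_def
  have hm : 0 ≤ m := integral_nonneg fun ω => abs_nonneg _
  have h0 : ∫⁻ ω, ‖ε 0 ω‖ₑ ∂P = ENNReal.ofReal m :=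
    (ofReal_integral_norm_eq_lintegral_enorm hint).symm
  have hεm : ∀ t, ∫⁻ ω, ‖ε t ω‖ₑ ∂P ≤ ENNReal.ofReal m := fun t =>
    (((hid t).comp measurable_enorm).lintegral_eq.trans h0).le
  have hεm' : ∀ t, ∫⁻ ω, ‖ε' t ω‖ₑ ∂P ≤ ENNReal.ofReal m := fun t =>
    (((hid' t).comp measurable_enorm).lintegral_eq.trans h0).le
  have hXmeas : ∀ {η : ℤ → Ω → ℝ} {Y : ℤ → Ω → ℝ}, (∀ t, Measurable (η t)) →
      (∀ t ω, Y t ω = ∑' k : ℕ, α k * η (t - k) ω) → ∀ u, Measurable (Y u) := by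
    intro η Y hη hY u
    rw [show Y u = fun ω => ∑' k : ℕ, α k * η (u - k) ω from funext (hY u)]
    exact Measurable.tsum fun k => (hη _).const_mul _
  have hX_meas := hXmeas hmeas hX
  have hX_meas' := hXmeas hmeas' hX'
  have hterm : ∀ j, ∫⁻ ω, ‖X (t j) ω - X' (t j) ω‖ₑ ∂P
      ≤ ENNReal.ofReal (K * (2 * m) * ρ ^ n / (1 - ρ)) := by
    intro j
    have hj : t ⟨0, hl⟩ ≤ t j := ht (Fin.mk_le_of_le_val (Nat.zero_le _))
    simp only [hX, hX']
    exact lintegral_enorm_causal_series_sub_le hmeas hmeas' hm hεm hεm' heq hK hρ0 hρ1 hα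
      (by omega)
  have h1ρ : 0 < 1 - ρ := sub_pos.2 hρ1
  have hnonneg : 0 ≤ K * (2 * m) * ρ ^ n / (1 - ρ) := by positivity
  have hdiff : ∀ j, Measurable fun ω => X (t j) ω - X' (t j) ω := fun j =>
    (hX_meas (t j)).sub (hX_meas' (t j))
  rw [integral_eq_lintegral_of_nonneg_ae
    (Filter.Eventually.of_forall fun ω => Finset.sum_nonneg fun j _ => abs_nonneg _)
    (Finset.measurable_fun_sum _ fun j _ => (hdiff j).abs).aestronglyMeasurable]
  refine ENNReal.toReal_le_of_le_ofReal (by positivity) ?_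
  calc ∫⁻ ω, ENNReal.ofReal (∑ j, |X (t j) ω - X' (t j) ω|) ∂P
      = ∑ j, ∫⁻ ω, ‖X (t j) ω - X' (t j) ω‖ₑ ∂P := by
        rw [← lintegral_finsetSum _ fun j _ => (hdiff j).enorm]
        simp only [ENNReal.ofReal_sum_of_nonneg fun _ _ => abs_nonneg _, Real.enorm_eq_ofReal_abs]
    _ ≤ ∑ _j : Fin l, ENNReal.ofReal (K * (2 * m) * ρ ^ n / (1 - ρ)) :=
        Finset.sum_le_sum fun j _ => hterm j
    _ = ENNReal.ofReal (2 * l * K * ρ ^ n * m / (1 - ρ)) := by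
        rw [← ENNReal.ofReal_sum_of_nonneg fun _ _ => hnonneg, Finset.sum_const,
          Finset.card_univ, Fintype.card_fin, nsmul_eq_mul]
        congr 1
        ring
end

section
/- Let X_1, …, X_n be real-valued random variables with zero mean on a probability space (Ω, A, P) such that all moments E|X_t|^k are finite. Let Ψ : ℕ² → ℝ be one of the functions (a) Ψ(u,v) = 2v, (b) Ψ(u,v) = u + v, (c) Ψ(u,v) = uv, (d) Ψ(u,v) = α(u+v) + (1−α)uv for some α ∈ (0,1). Assume there are constants K, M, L₁, L₂ < ∞, μ, ν ≥ 0 and a nonincreasing sequence (ρ(r))_{r≥0} of nonnegative reals such that: (4.12) for all u-tuples (s_1,…,s_u) and v-tuples (t_1,…,t_v) with 1 ≤ s_1 ≤ … ≤ s_u ≤ t_1 ≤ … ≤ t_v ≤ n, |cov(X_{s_1}⋯X_{s_u}, X_{t_1}⋯X_{t_v})| ≤ K² M^{u+v−2} ((u+v)!)^ν Ψ(u,v) ρ(t_1 − s_u); (4.13) Σ_{s=0}^∞ (s+1)^k ρ(s) ≤ L₁ L₂^k (k!)^μ for all k ≥ 0; (4.14) E|X_t|^k ≤ (k!)^ν M^k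 for all k ≥ 0 and t = 1,…,n. Let S_n = X_1 + ⋯ + X_n, σ_n² = var(S_n), let A_n be any real number with A_n ≥ σ_n² and A_n > 0, and set B_n = 2(K ∨ M) L₂ · (((2^{4+μ+ν} n K² L₁)/A_n) ∨ 1). Then for all t ≥ 0, P(S_n ≥ t) ≤ exp( − (t²/2) / ( A_n + B_n^{1/(μ+ν+2)} · t^{(2μ+2ν+3)/(μ+ν+2)} ) ). -/
open MeasureTheory ProbabilityTheory

/-- The Taylor polynomial of degree `N` of the exponential function at `0`. -/
noncomputable def expPoly (N : ℕ) (z : ℝ) : ℝ :=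
  ∑ k ∈ Finset.range (N + 1), z ^ k / (Nat.factorial k : ℝ)

lemma expPoly_succ (N : ℕ) (z : ℝ) :
    expPoly (N + 1) z = expPoly N z + z ^ (N + 1) / (Nat.factorial (N + 1) : ℝ) := by
  simp only [expPoly, Finset.sum_range_succ _ (N + 1)]

lemma hasDerivAt_pow_succ_div_factorial (N : ℕ) (z : ℝ) :
    HasDerivAt (fun z : ℝ => z ^ (N + 1) / (Nat.factorial (N + 1) : ℝ))
      (z ^ N / (Nat.factorial N : ℝ)) z := by
  refine ((hasDerivAt_pow (N + 1) z).div_const (Nat.factorial (N + 1) : ℝ)).congr_deriv ?_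
  have h : (Nat.factorial N : ℝ) ≠ 0 := by positivity
  rw [Nat.factorial_succ]
  push_cast
  field_simp

lemma hasDerivAt_expPoly (N : ℕ) (z : ℝ) :
    HasDerivAt (expPoly (N + 1)) (expPoly N z) z := by
  induction N with
  | zero =>
    have h := (hasDerivAt_pow_succ_div_factorial 0 z).const_add (1 : ℝ)
    have e : expPoly (0 + 1) = fun y : ℝ => 1 + y ^ (0 + 1) / (Nat.factorial (0 + 1) : ℝ) := by
      ext y
      simp [expPoly, Finset.sum_range_succ]
    rw [e]
    exact h.congr_deriv (by simp [expPoly])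
  | succ N ih =>
    have h := ih.add (hasDerivAt_pow_succ_div_factorial (N + 1) z)
    rw [expPoly_succ N z]
    refine h.congr_of_eventuallyEq (Filter.Eventually.of_forall fun y => ?_)
    exact expPoly_succ (N + 1) y

lemma expPoly_zero_right (N : ℕ) : expPoly N 0 = 1 := by
  simp [expPoly, Finset.sum_range_succ']

lemma expPoly_mono_nonneg (N : ℕ) {x y : ℝ} (hx : 0 ≤ x) (hxy : x ≤ y) :
    expPoly N x ≤ expPoly N y := by
  unfold expPoly
  gcongr

lemma expPoly_sub_exp_alternating (N : ℕ) {w : ℝ} (hw : 0 ≤ w) :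
    0 ≤ (-1 : ℝ) ^ N * (expPoly N (-w) - Real.exp (-w)) := by
  induction N generalizing w with
  | zero => simpa [expPoly] using hw
  | succ N ih =>
    have hd : ∀ w : ℝ, HasDerivAt
        (fun w : ℝ => (-1 : ℝ) ^ (N + 1) * (expPoly (N + 1) (-w) - Real.exp (-w)))
        ((-1 : ℝ) ^ N * (expPoly N (-w) - Real.exp (-w))) w := by
      intro w
      have h1 := (hasDerivAt_expPoly N (-w)).scomp w (hasDerivAt_neg w)
      have h2 := (Real.hasDerivAt_exp (-w)).scomp w (hasDerivAt_neg w)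
      refine ((h1.sub h2).const_mul ((-1 : ℝ) ^ (N + 1))).congr_deriv ?_
      simp only [smul_eq_mul]
      ring
    have hm : MonotoneOn
        (fun w : ℝ => (-1 : ℝ) ^ (N + 1) * (expPoly (N + 1) (-w) - Real.exp (-w)))
        (Set.Ici 0) := by
      refine monotoneOn_of_deriv_nonneg (convex_Ici 0)
        (fun x _ => (hd x).continuousAt.continuousWithinAt)
        (fun x _ => (hd x).differentiableAt.differentiableWithinAt) ?_
      intro x hx
      rw [interior_Ici] at hx
      rw [(hd x).deriv]
      exact ih hx.le
    have h := hm (Set.mem_Ici.2 le_rfl) (Set.mem_Ici.2 hw) hw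
    simpa [expPoly_zero_right] using h

lemma expPoly_nonneg_of_even {N : ℕ} (hN : Even N) (z : ℝ) : 0 ≤ expPoly N z := by
  rcases le_total 0 z with hz | hz
  · unfold expPoly
    positivity
  · have h := expPoly_sub_exp_alternating N (neg_nonneg.2 hz)
    rw [hN.neg_one_pow, neg_neg, one_mul] at h
    linarith [Real.exp_pos z]

/-- A lower bound of Gaussian type for the Taylor polynomials of the exponential function. -/
lemma exp_sub_sq_le_expPoly {N : ℕ} (hN : 2 ≤ N) {a : ℝ} (ha : 0 ≤ a) :
    Real.exp (a - a ^ 2 / (2 * (3 * N - 2))) ≤ expPoly N a := by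
  obtain ⟨j, rfl⟩ := Nat.exists_eq_add_of_le' hN
  set s : ℝ := 3 * ((j + 2 : ℕ) : ℝ) - 2 with hs
  have hs0 : 0 < s := by rw [hs]; push_cast; linarith [(Nat.cast_nonneg j : (0:ℝ) ≤ j)]
  have hd : ∀ a : ℝ, HasDerivAt
      (fun a : ℝ => expPoly (j + 2) a * Real.exp (-(a - a ^ 2 / (2 * s))))
      (Real.exp (-(a - a ^ 2 / (2 * s))) *
        (a / s * expPoly (j + 2) a - a ^ (j + 2) / (Nat.factorial (j + 2) : ℝ))) a := by
    intro a
    have h1 : HasDerivAt (fun a : ℝ => -(a - a ^ 2 / (2 * s))) (-(1 - a / s)) a := by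
      refine ((hasDerivAt_id' a).sub
        ((hasDerivAt_pow 2 a).div_const (2 * s))).neg.congr_deriv ?_
      field_simp
      simp
      ring
    refine ((hasDerivAt_expPoly (j + 1) a).mul h1.exp).congr_deriv ?_
    rw [expPoly_succ (j + 1)]
    ring
  have hm : MonotoneOn
      (fun a : ℝ => expPoly (j + 2) a * Real.exp (-(a - a ^ 2 / (2 * s)))) (Set.Ici 0) := by
    refine monotoneOn_of_deriv_nonneg (convex_Ici 0)
      (fun x _ => (hd x).continuousAt.continuousWithinAt)
      (fun x _ => (hd x).differentiableAt.differentiableWithinAt) ?_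
    intro x hx
    rw [interior_Ici, Set.mem_Ioi] at hx
    rw [(hd x).deriv]
    refine mul_nonneg (Real.exp_pos _).le (sub_nonneg.2 ?_)
    have hlow : x ^ j / (Nat.factorial j : ℝ) + x ^ (j + 1) / (Nat.factorial (j + 1) : ℝ)
        + x ^ (j + 2) / (Nat.factorial (j + 2) : ℝ) ≤ expPoly (j + 2) x := by
      rw [expPoly_succ, expPoly_succ]
      have : x ^ j / (Nat.factorial j : ℝ) ≤ expPoly j x :=
        Finset.single_le_sum (f := fun k => x ^ k / (Nat.factorial k : ℝ))
          (fun k _ => by positivity) (Finset.self_mem_range_succ j)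
      linarith
    have hkey : x ^ (j + 2) / (Nat.factorial (j + 2) : ℝ) ≤ x / s *
        (x ^ j / (Nat.factorial j : ℝ) + x ^ (j + 1) / (Nat.factorial (j + 1) : ℝ)
        + x ^ (j + 2) / (Nat.factorial (j + 2) : ℝ)) := by
      have hf : (Nat.factorial j : ℝ) ≠ 0 := by positivity
      have e : x / s * (x ^ j / (Nat.factorial j : ℝ)
          + x ^ (j + 1) / (Nat.factorial (j + 1) : ℝ)
          + x ^ (j + 2) / (Nat.factorial (j + 2) : ℝ))
          = x ^ (j + 1) / (s * (Nat.factorial (j + 2) : ℝ))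
            * (((j : ℝ) + 2) * (j + 1) + (j + 2) * x + x ^ 2) := by
        rw [Nat.factorial_succ (j + 1), Nat.factorial_succ j]
        push_cast
        field_simp
        ring
      have e2 : x ^ (j + 2) / (Nat.factorial (j + 2) : ℝ)
          = x ^ (j + 1) / (s * (Nat.factorial (j + 2) : ℝ)) * (s * x) := by
        field_simp
        ring
      rw [e, e2]
      refine mul_le_mul_of_nonneg_left ?_ (by positivity)
      rw [hs]
      push_cast
      nlinarith [sq_nonneg (x - (j + 1))]
    exact hkey.trans (mul_le_mul_of_nonneg_left hlow (by positivity))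
  have h := hm (Set.mem_Ici.2 le_rfl) (Set.mem_Ici.2 ha) ha
  simp only [expPoly_zero_right, ne_eq, OfNat.ofNat_ne_zero, not_false_eq_true, zero_pow,
    zero_div, sub_zero, neg_zero, Real.exp_zero, mul_one, Real.exp_neg] at h
  rwa [← div_eq_mul_inv, le_div_iff₀ (Real.exp_pos _), one_mul] at h

/-- Moments defined from cumulants through the usual recursion are dominated by the exponential
of the absolute cumulant generating polynomial. -/
lemma sum_abs_moment_le_exp (m G : ℕ → ℝ) (h0 : m 0 = 1)
    (hrec : ∀ k, m (k + 1) = ∑ j ∈ Finset.range (k + 1), (k.choose j : ℝ) * (G j * m (k - j)))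
    (N : ℕ) {h : ℝ} (hh : 0 ≤ h) :
    ∑ k ∈ Finset.range (N + 1), |m k| * (h ^ k / (Nat.factorial k : ℝ))
      ≤ Real.exp (∑ j ∈ Finset.range N, |G j| * (h ^ (j + 1) / (Nat.factorial (j + 1) : ℝ))) := by
  set F : ℝ → ℝ := fun h => ∑ k ∈ Finset.range (N + 1), |m k| * (h ^ k / (Nat.factorial k : ℝ))
    with hF
  set c : ℝ → ℝ := fun h =>
    ∑ j ∈ Finset.range N, |G j| * (h ^ (j + 1) / (Nat.factorial (j + 1) : ℝ)) with hc
  have hF' : ∀ h, HasDerivAt F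
      (∑ k ∈ Finset.range N, |m (k + 1)| * (h ^ k / (Nat.factorial k : ℝ))) h := by
    intro h
    have e : F = fun h => ∑ k ∈ Finset.range N,
        |m (k + 1)| * (h ^ (k + 1) / (Nat.factorial (k + 1) : ℝ)) + 1 := by
      ext y
      simp [hF, Finset.sum_range_succ', h0]
    rw [e]
    exact (HasDerivAt.fun_sum fun k _ =>
      (hasDerivAt_pow_succ_div_factorial k h).const_mul _).add_const _
  have hc' : ∀ h, HasDerivAt c
      (∑ j ∈ Finset.range N, |G j| * (h ^ j / (Nat.factorial j : ℝ))) h := fun h =>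
    HasDerivAt.fun_sum fun k _ => (hasDerivAt_pow_succ_div_factorial k h).const_mul _
  have hle : ∀ h, 0 ≤ h →
      ∑ k ∈ Finset.range N, |m (k + 1)| * (h ^ k / (Nat.factorial k : ℝ))
        ≤ (∑ j ∈ Finset.range N, |G j| * (h ^ j / (Nat.factorial j : ℝ))) * F h := by
    intro h hh
    calc ∑ k ∈ Finset.range N, |m (k + 1)| * (h ^ k / (Nat.factorial k : ℝ))
        ≤ ∑ k ∈ Finset.range N, ∑ j ∈ Finset.range (k + 1),
            (|G j| * (h ^ j / (Nat.factorial j : ℝ)))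
              * (|m (k - j)| * (h ^ (k - j) / (Nat.factorial (k - j) : ℝ))) := by
          refine Finset.sum_le_sum fun k _ => ?_
          rw [hrec]
          calc _ ≤ (∑ j ∈ Finset.range (k + 1), |(k.choose j : ℝ) * (G j * m (k - j))|)
                * (h ^ k / (Nat.factorial k : ℝ)) := by
                gcongr
                exact Finset.abs_sum_le_sum_abs _ _
            _ = _ := by
              rw [Finset.sum_mul]
              refine Finset.sum_congr rfl fun j hj => ?_
              have hjk : j ≤ k := Nat.lt_succ_iff.1 (Finset.mem_range.1 hj)
              rw [abs_mul, abs_mul, Nat.abs_cast, Nat.cast_choose ℝ hjk]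
              have : h ^ k = h ^ j * h ^ (k - j) := by rw [← pow_add, Nat.add_sub_cancel' hjk]
              rw [this]
              have h1 : (Nat.factorial k : ℝ) ≠ 0 := by positivity
              field_simp
      _ = ∑ j ∈ Finset.range N, ∑ i ∈ Finset.range (N - j),
            (|G j| * (h ^ j / (Nat.factorial j : ℝ)))
              * (|m i| * (h ^ i / (Nat.factorial i : ℝ))) :=
          Finset.sum_range_diag_flip N fun j i => (|G j| * (h ^ j / (Nat.factorial j : ℝ)))
              * (|m i| * (h ^ i / (Nat.factorial i : ℝ)))
      _ ≤ _ := by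
          rw [Finset.sum_mul]
          refine Finset.sum_le_sum fun j _ => ?_
          rw [← Finset.mul_sum]
          refine mul_le_mul_of_nonneg_left ?_ (by positivity)
          refine Finset.sum_le_sum_of_subset_of_nonneg
            (Finset.range_mono (by omega)) fun _ _ _ => by positivity
  have hd : ∀ h, HasDerivAt (fun h => F h * Real.exp (-c h))
      (Real.exp (-c h) * ((∑ k ∈ Finset.range N, |m (k + 1)| * (h ^ k / (Nat.factorial k : ℝ)))
        - (∑ j ∈ Finset.range N, |G j| * (h ^ j / (Nat.factorial j : ℝ))) * F h)) h := by
    intro h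
    refine ((hF' h).mul (hc' h).neg.exp).congr_deriv ?_
    rw [Pi.neg_apply]
    ring
  have hanti : AntitoneOn (fun h => F h * Real.exp (-c h)) (Set.Ici 0) := by
    refine antitoneOn_of_deriv_nonpos (convex_Ici 0)
      (fun x _ => (hd x).continuousAt.continuousWithinAt)
      (fun x _ => (hd x).differentiableAt.differentiableWithinAt) ?_
    intro x hx
    rw [interior_Ici, Set.mem_Ioi] at hx
    rw [(hd x).deriv]
    exact mul_nonpos_of_nonneg_of_nonpos (Real.exp_pos _).le (sub_nonpos.2 (hle x hx.le))
  have h1 := hanti (Set.mem_Ici.2 le_rfl) (Set.mem_Ici.2 hh) hh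
  have hF0 : F 0 = 1 := by simp [hF, Finset.sum_range_succ', h0]
  have hc0 : c 0 = 0 := by simp [hc]
  simp only [hF0, hc0, neg_zero, Real.exp_zero, mul_one, Real.exp_neg] at h1
  rwa [← div_eq_mul_inv, div_le_iff₀ (Real.exp_pos _), one_mul] at h1

/-- **Cantelli's inequality** with an upper bound on the second moment. -/
lemma measureReal_ge_le_cantelli {Ω : Type*} [MeasurableSpace Ω] (P : Measure Ω)
    [IsProbabilityMeasure P] {S : Ω → ℝ} (hS1 : Integrable S P)
    (hS2 : Integrable (fun ω => S ω ^ 2) P) (hmean : ∫ ω, S ω ∂P = 0) {A x : ℝ} (hA : 0 < A)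
    (hvar : ∫ ω, S ω ^ 2 ∂P ≤ A) (hx : 0 < x) :
    P.real {ω | x ≤ S ω} ≤ A / (A + x ^ 2) := by
  have hi : Integrable (fun ω => (S ω + A / x) ^ 2) P := by
    have : (fun ω => (S ω + A / x) ^ 2) =
        fun ω => S ω ^ 2 + (2 * (A / x)) * S ω + (A / x) ^ 2 := by
      ext ω
      ring
    rw [this]
    exact (hS2.add (hS1.const_mul _)).add (integrable_const _)
  have hE : ∫ ω, (S ω + A / x) ^ 2 ∂P = ∫ ω, S ω ^ 2 ∂P + (A / x) ^ 2 := by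
    have : (fun ω => (S ω + A / x) ^ 2) =
        fun ω => (S ω ^ 2 + (2 * (A / x)) * S ω) + (A / x) ^ 2 := by
      ext ω
      ring
    rw [this, integral_add (by exact hS2.add (hS1.const_mul _)) (integrable_const _),
      integral_add hS2 (hS1.const_mul _), integral_const_mul, hmean]
    simp
  have hmarkov := mul_meas_ge_le_integral_of_nonneg
    (Filter.Eventually.of_forall fun ω => sq_nonneg (S ω + A / x)) hi ((x + A / x) ^ 2)
  have hsub : P.real {ω | x ≤ S ω} ≤ P.real {ω | (x + A / x) ^ 2 ≤ (S ω + A / x) ^ 2} := by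
    refine measureReal_mono fun ω hω => ?_
    have hω' : x ≤ S ω := hω
    have : 0 < A / x := by positivity
    show (x + A / x) ^ 2 ≤ (S ω + A / x) ^ 2
    gcongr
  have hfin : (x + A / x) ^ 2 * P.real {ω | x ≤ S ω} ≤ A + (A / x) ^ 2 := by
    calc _ ≤ (x + A / x) ^ 2 * P.real {ω | (x + A / x) ^ 2 ≤ (S ω + A / x) ^ 2} := by gcongr
      _ ≤ _ := hmarkov
      _ ≤ _ := by rw [hE]; linarith
  rw [le_div_iff₀ (by positivity)]
  have e1 : (x + A / x) ^ 2 = (A + x ^ 2) * ((A + x ^ 2) / x ^ 2) := by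
    field_simp
    ring
  have e2 : A + (A / x) ^ 2 = A * ((A + x ^ 2) / x ^ 2) := by
    field_simp
    ring
  rw [e1, e2] at hfin
  refine le_of_mul_le_mul_right ?_ (show 0 < (A + x ^ 2) / x ^ 2 by positivity)
  linarith

lemma four_mul_div_add_eight_le_log {z : ℝ} (hz : 0 ≤ z) : 4 * z / (z + 8) ≤ Real.log (1 + z) := by
  obtain ⟨w, hw1, hw⟩ : ∃ w : ℝ, 1 ≤ w ∧ w ^ 4 = 1 + z := by
    refine ⟨(1 + z) ^ ((1 : ℝ) / 4), Real.one_le_rpow (by linarith) (by norm_num), ?_⟩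
    rw [← Real.rpow_natCast, ← Real.rpow_mul (by linarith)]
    norm_num
  have hlog : 2 * (w - 1) / (w + 1) ≤ Real.log w := by
    have h := Real.le_log_one_add_of_nonneg (sub_nonneg.2 hw1)
    rw [add_sub_cancel] at h
    convert h using 2
    ring
  rw [← hw, Real.log_pow]
  have hzw : z = w ^ 4 - 1 := by linarith
  push_cast
  refine le_trans ?_ (mul_le_mul_of_nonneg_left hlog (by norm_num))
  rw [hzw, mul_div_assoc', div_le_div_iff₀ (by nlinarith [sq_nonneg (w ^ 2)]) (by linarith)]
  have hq : 0 ≤ w ^ 4 - 2 * w ^ 3 - 2 * w ^ 2 - 2 * w + 13 := by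
    nlinarith [sq_nonneg (w ^ 2 - w - 2), sq_nonneg (w - 2), sq_nonneg (w - 2.1),
      sq_nonneg (w ^ 2 - w - 2.3)]
  nlinarith [mul_nonneg (sub_nonneg.2 hw1) hq]

lemma cantelli_le_exp {A x m : ℝ} (hA : 0 < A) (hx : 0 < x) (hm : 0 < m) (hm8 : m ≤ 8) :
    A / (A + x ^ 2) ≤ Real.exp (-(x ^ 2 / 2) / (A + x ^ 2 / m)) := by
  have h := four_mul_div_add_eight_le_log (show 0 ≤ x ^ 2 / A by positivity)
  have e : A / (A + x ^ 2) = Real.exp (-Real.log (1 + x ^ 2 / A)) := by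
    rw [Real.exp_neg, Real.exp_log (by positivity)]
    field_simp
  rw [e, Real.exp_le_exp, neg_div, neg_le_neg_iff]
  refine le_trans ?_ h
  have e2 : 4 * (x ^ 2 / A) / (x ^ 2 / A + 8) = (x ^ 2 / 2) / (A + x ^ 2 / 8) := by
    field_simp
    ring
  rw [e2]
  gcongr

lemma factorial_half_div_pow_le {i : ℕ} {m : ℝ} (hm : (i : ℝ) + 3 ≤ m) :
    (Nat.factorial (i + 3) : ℝ) / 2 / m ^ (i + 1) ≤ 3 / m := by
  have hm0 : 0 < m := by linarith [(Nat.cast_nonneg i : (0 : ℝ) ≤ i)]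
  induction i with
  | zero => norm_num [Nat.factorial]
  | succ i ih =>
    push_cast at hm
    refine le_trans ?_ (ih (by linarith))
    have hf : (0 : ℝ) < (Nat.factorial (i + 3) : ℝ) := by positivity
    have e : (Nat.factorial (i + 1 + 3) : ℝ) / 2 / m ^ (i + 1 + 1)
        = (Nat.factorial (i + 3) : ℝ) / 2 / m ^ (i + 1) * (((i : ℝ) + 4) / m) := by
      rw [show i + 1 + 3 = (i + 3) + 1 by ring, Nat.factorial_succ]
      push_cast
      field_simp
      ring
    rw [e]
    refine mul_le_of_le_one_right (by positivity) ?_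
    rw [div_le_one hm0]
    linarith

lemma sum_factorial_rpow_geometric_le {γ m q : ℝ} (hγ : 1 ≤ γ) (hm : 3 ≤ m) (hq0 : 0 ≤ q)
    (hq1 : q ≤ 1) {N : ℕ} (hN : (N : ℝ) + 2 ≤ m) :
    (1 - q) * ∑ i ∈ Finset.range (N + 1),
        ((Nat.factorial (i + 2) : ℝ) / 2) ^ γ * (q / m ^ γ) ^ i ≤ (1 - q) + 3 / m * q := by
  have hm0 : 0 < m := by linarith
  rw [Finset.sum_range_succ']
  have hterm : ∀ i ∈ Finset.range N,
      ((Nat.factorial (i + 1 + 2) : ℝ) / 2) ^ γ * (q / m ^ γ) ^ (i + 1)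
        ≤ 3 / m * q * q ^ i := by
    intro i hi
    have hiN : (i : ℝ) + 1 ≤ N := by exact_mod_cast Finset.mem_range.1 hi
    have h1 := factorial_half_div_pow_le (i := i) (m := m) (by linarith)
    have e : ((Nat.factorial (i + 1 + 2) : ℝ) / 2) ^ γ * (q / m ^ γ) ^ (i + 1)
        = ((Nat.factorial (i + 3) : ℝ) / 2 / m ^ (i + 1)) ^ γ * q ^ (i + 1) := by
      rw [Real.div_rpow (x := (Nat.factorial (i + 3) : ℝ) / 2) (by positivity) (by positivity) γ,
        ← Real.rpow_pow_comm hm0.le, div_pow]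
      ring
    rw [e]
    have h2 : ((Nat.factorial (i + 3) : ℝ) / 2 / m ^ (i + 1)) ^ γ ≤ 3 / m := by
      refine le_trans ?_ h1
      refine Real.rpow_le_self_of_le_one (by positivity) (h1.trans ?_) hγ
      rw [div_le_one hm0]
      exact hm
    rw [mul_assoc (3 / m), ← pow_succ']
    gcongr
  have h0 : ((Nat.factorial (0 + 2) : ℝ) / 2) ^ γ * (q / m ^ γ) ^ 0 = 1 := by
    norm_num [Nat.factorial]
  have hgeom := mul_neg_geom_sum q N
  have hsum := Finset.sum_le_sum hterm
  rw [← Finset.mul_sum] at hsum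
  have h1q : 0 ≤ 1 - q := by linarith
  rw [h0]
  calc _ ≤ (1 - q) * (3 / m * q * ∑ i ∈ Finset.range N, q ^ i + 1) := by gcongr
    _ = (1 - q) + 3 / m * q * (1 - q ^ N) := by rw [← hgeom]; ring
    _ ≤ (1 - q) + 3 / m * q * 1 := by
      gcongr
      linarith [pow_nonneg hq0 N]
    _ = _ := by ring

lemma expPoly_integral_le {Ω : Type*} [MeasurableSpace Ω] (P : Measure Ω)
    {S : Ω → ℝ} (hinteg : ∀ k : ℕ, Integrable (fun ω => S ω ^ k) P) (N : ℕ) {h : ℝ} (hh : 0 ≤ h) :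
    Integrable (fun ω => expPoly N (h * S ω)) P ∧
    ∫ ω, expPoly N (h * S ω) ∂P ≤
      ∑ k ∈ Finset.range (N + 1), |∫ ω, S ω ^ k ∂P| * (h ^ k / (Nat.factorial k : ℝ)) := by
  have e : (fun ω => expPoly N (h * S ω)) = fun ω => ∑ k ∈ Finset.range (N + 1),
      (h ^ k / (Nat.factorial k : ℝ)) * S ω ^ k := by
    ext ω
    refine Finset.sum_congr rfl fun k _ => ?_
    rw [mul_pow]
    ring
  rw [e]
  refine ⟨integrable_finsetSum _ fun k _ => (hinteg k).const_mul _, ?_⟩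
  rw [integral_finsetSum _ fun k _ => (hinteg k).const_mul _]
  refine Finset.sum_le_sum fun k _ => ?_
  rw [integral_const_mul, mul_comm]
  gcongr
  exact le_abs_self _

/-- A tail bound for a random variable whose cumulants `G j` (of order `j + 1`) grow at most like
a power of the factorials. -/
lemma tail_le_exp_of_cumulant_bound {Ω : Type*} [MeasurableSpace Ω] (P : Measure Ω)
    [IsProbabilityMeasure P] {S : Ω → ℝ}
    (hinteg : ∀ k : ℕ, Integrable (fun ω => S ω ^ k) P) (G : ℕ → ℝ)
    (hrec : ∀ k : ℕ, ∫ ω, S ω ^ (k + 1) ∂P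
      = ∑ j ∈ Finset.range (k + 1), (k.choose j : ℝ) * (G j * ∫ ω, S ω ^ (k - j) ∂P))
    (hG0 : G 0 = 0) {γ A B : ℝ} (hγ : 1 ≤ γ) (hA : 0 < A) (hB : 0 < B)
    (hG : ∀ j : ℕ, |G (j + 1)| ≤ ((Nat.factorial (j + 2) : ℝ) / 2) ^ (1 + γ) * A * B ^ j)
    {x : ℝ} (hx : 0 < x) :
    P.real {ω | x ≤ S ω} ≤ Real.exp (-(x ^ 2 / 2) /
      (A + B ^ (1 / (1 + γ)) * x ^ ((1 + 2 * γ) / (1 + γ)))) := by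
  have hmean : ∫ ω, S ω ∂P = 0 := by simpa [hG0] using hrec 0
  have hsecond : ∫ ω, S ω ^ 2 ∂P ≤ A := by
    have h1 := hrec 1
    have h2 := (le_abs_self _).trans (hG 0)
    simp [Finset.sum_range_succ, hG0, Nat.factorial] at h1 h2
    rw [h1]
    exact h2
  set m : ℝ := (x / B) ^ (1 / (1 + γ)) with hm
  have hm0 : 0 < m := by positivity
  have hmpow : m ^ (1 + γ) = x / B := by
    rw [hm, ← Real.rpow_mul (by positivity), one_div, inv_mul_cancel₀ (by linarith),
      Real.rpow_one]
  have hden : B ^ (1 / (1 + γ)) * x ^ ((1 + 2 * γ) / (1 + γ)) = x ^ 2 / m := by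
    have e : (1 + 2 * γ) / (1 + γ) = 2 - 1 / (1 + γ) := by
      have : 1 + γ ≠ 0 := by linarith
      field_simp
      ring
    rw [hm, e, Real.div_rpow hx.le hB.le, Real.rpow_sub hx, Real.rpow_two]
    field_simp
  rw [hden]
  rcases le_total m 8 with hm8 | hm8
  · refine le_trans ?_ (cantelli_le_exp hA hx hm0 hm8)
    exact measureReal_ge_le_cantelli P (by simpa using hinteg 1) (hinteg 2) hmean hA hsecond hx
  obtain ⟨N, hN1, hN2, hNeven⟩ : ∃ N : ℕ, (N : ℝ) + 2 ≤ m ∧ m < (N : ℝ) + 4 ∧ Even (N + 2) := by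
    have hfl : 4 ≤ ⌊m / 2⌋₊ := Nat.le_floor (by push_cast; linarith)
    have h1 := Nat.floor_le (show 0 ≤ m / 2 by positivity)
    have h2 := Nat.lt_floor_add_one (m / 2)
    refine ⟨2 * ⌊m / 2⌋₊ - 2, ?_, ?_, ?_⟩
    · rw [Nat.cast_sub (by omega)]
      push_cast
      linarith
    · rw [Nat.cast_sub (by omega)]
      push_cast
      linarith
    · exact ⟨⌊m / 2⌋₊, by omega⟩
  set q : ℝ := x ^ 2 / (x ^ 2 + A * m) with hq
  have hq0 : 0 < q := by positivity
  have hq1' : 1 - q = A * m / (x ^ 2 + A * m) := by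
    rw [hq]
    field_simp
    ring
  have hq1 : 0 < 1 - q := by rw [hq1']; positivity
  set a : ℝ := q * m with ha
  set h : ℝ := a / x with hh
  have hh0 : 0 < h := by positivity
  have hAh : A * h ^ 2 = a * (1 - q) := by
    rw [hq1', hh, ha, hq]
    field_simp
  have hBh : B * h = q / m ^ γ := by
    have e : B = x / m ^ (1 + γ) := by
      rw [hmpow]
      field_simp
    rw [e, hh, ha, Real.rpow_add hm0, Real.rpow_one]
    field_simp
  have hexp : ∑ j ∈ Finset.range (N + 2), |G j| * (h ^ (j + 1) / (Nat.factorial (j + 1) : ℝ))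
      ≤ a / 2 * ((1 - q) + 3 / m * q) := by
    rw [Finset.sum_range_succ', hG0]
    calc _ ≤ ∑ i ∈ Finset.range (N + 1), (A * h ^ 2 / 2) *
          (((Nat.factorial (i + 2) : ℝ) / 2) ^ γ * (q / m ^ γ) ^ i) := by
          simp only [abs_zero, zero_mul, add_zero]
          refine Finset.sum_le_sum fun i _ => ?_
          calc _ ≤ ((Nat.factorial (i + 2) : ℝ) / 2) ^ (1 + γ) * A * B ^ i
                * (h ^ (i + 1 + 1) / (Nat.factorial (i + 1 + 1) : ℝ)) := by
                gcongr
                exact hG i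
            _ = _ := by
              rw [← hBh, Real.rpow_add (by positivity), Real.rpow_one, mul_pow]
              have : (Nat.factorial (i + 2) : ℝ) ≠ 0 := by positivity
              field_simp
              ring
      _ = a / 2 * ((1 - q) * ∑ i ∈ Finset.range (N + 1),
          ((Nat.factorial (i + 2) : ℝ) / 2) ^ γ * (q / m ^ γ) ^ i) := by
          rw [← Finset.mul_sum, hAh]
          ring
      _ ≤ _ := by
          refine mul_le_mul_of_nonneg_left ?_ (by positivity)
          exact sum_factorial_rpow_geometric_le hγ (by linarith) hq0.le (by linarith) hN1
  obtain ⟨hi, hE⟩ := expPoly_integral_le P hinteg (N + 2) hh0.le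
  have hE2 := hE.trans (sum_abs_moment_le_exp (fun k => ∫ ω, S ω ^ k ∂P) G (by simp) hrec (N + 2)
    hh0.le)
  have hE3 := hE2.trans (Real.exp_le_exp.2 hexp)
  have hmarkov := mul_meas_ge_le_integral_of_nonneg
    (Filter.Eventually.of_forall fun ω => expPoly_nonneg_of_even hNeven (h * S ω)) hi
    (expPoly (N + 2) (h * x))
  have hsub : P.real {ω | x ≤ S ω}
      ≤ P.real {ω | expPoly (N + 2) (h * x) ≤ expPoly (N + 2) (h * S ω)} := by
    refine measureReal_mono fun ω hω => ?_
    exact expPoly_mono_nonneg _ (by positivity) (mul_le_mul_of_nonneg_left hω hh0.le)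
  have hhx : h * x = a := by
    rw [hh]
    field_simp
  rw [hhx] at hmarkov hsub
  have hlow := exp_sub_sq_le_expPoly (N := N + 2) (by omega) (show 0 ≤ a by positivity)
  have hprod : Real.exp (a - a ^ 2 / (2 * (3 * ((N + 2 : ℕ) : ℝ) - 2))) * P.real {ω | x ≤ S ω}
      ≤ Real.exp (a / 2 * ((1 - q) + 3 / m * q)) := by
    refine le_trans ?_ (hmarkov.trans hE3)
    exact mul_le_mul hlow hsub measureReal_nonneg ((Real.exp_pos _).le.trans hlow)
  have hs : m * (1 / (3 * ((N + 2 : ℕ) : ℝ) - 2)) ≤ 1 - 3 / m := by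
    push_cast
    have hpos : 0 < 3 * m - 8 := by linarith
    calc m * (1 / (3 * ((N : ℝ) + 2) - 2)) ≤ m * (1 / (3 * m - 8)) := by
          refine mul_le_mul_of_nonneg_left ?_ hm0.le
          exact one_div_le_one_div_of_le hpos (by linarith)
      _ ≤ 1 - 3 / m := by
          rw [mul_one_div, one_sub_div hm0.ne', div_le_div_iff₀ hpos hm0]
          nlinarith
  rw [mul_comm, ← le_div_iff₀ (Real.exp_pos _), ← Real.exp_sub] at hprod
  refine hprod.trans (Real.exp_le_exp.2 ?_)
  have etarget : -(x ^ 2 / 2) / (A + x ^ 2 / m) = -(a / 2) := by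
    rw [ha, hq]
    field_simp
    ring
  rw [etarget]
  have e : a / 2 * ((1 - q) + 3 / m * q) - (a - a ^ 2 / (2 * (3 * ((N + 2 : ℕ) : ℝ) - 2)))
      = -(a / 2) + a / 2 * q *
        (m * (1 / (3 * ((N + 2 : ℕ) : ℝ) - 2)) - (1 - 3 / m)) := by
    have h3 : (3 * ((N + 2 : ℕ) : ℝ) - 2) ≠ 0 := by
      push_cast
      linarith [(Nat.cast_nonneg N : (0 : ℝ) ≤ N)]
    set s : ℝ := 3 * ((N + 2 : ℕ) : ℝ) - 2
    rw [ha]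
    field_simp
    ring
  rw [e]
  have : a / 2 * q * (m * (1 / (3 * ((N + 2 : ℕ) : ℝ) - 2)) - (1 - 3 / m)) ≤ 0 :=
    mul_nonpos_of_nonneg_of_nonpos (by positivity) (by linarith)
  linarith

/-- The joint cumulant of a distinguished variable together with the variables indexed by `J`,
expressed through the moments `m₀` (with the distinguished variable) and `m₁` (without it). -/
noncomputable def subsetCumulant {α : Type*} [DecidableEq α] (m₀ m₁ : Finset α → ℝ)
    (J : Finset α) : ℝ :=
  m₀ J - ∑ I : {I // I ∈ J.ssubsets}, subsetCumulant m₀ m₁ I.1 * m₁ (J \ I.1)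
termination_by J.card
decreasing_by exact Finset.card_lt_card (Finset.mem_ssubsets.1 I.2)

/-- The cumulant of order `k + 1` of a random variable with moments `φ`. -/
noncomputable def cumulantSeq (φ : ℕ → ℝ) (k : ℕ) : ℝ :=
  φ (k + 1) - ∑ i : Fin k, (k.choose i : ℝ) * (cumulantSeq φ i * φ (k - i))
termination_by k

/-- The numbers bounding joint cumulants of variables whose moments are bounded by `1`. -/
noncomputable def cumulantConst (k : ℕ) : ℝ :=
  1 + ∑ i : Fin k, (k.choose i : ℝ) * cumulantConst i
termination_by k

section SubsetCumulant

variable {α : Type*} [DecidableEq α]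

lemma subsetCumulant_eq (m₀ m₁ : Finset α → ℝ) (J : Finset α) :
    subsetCumulant m₀ m₁ J =
      m₀ J - ∑ I ∈ J.ssubsets, subsetCumulant m₀ m₁ I * m₁ (J \ I) := by
  rw [subsetCumulant, Finset.sum_coe_sort J.ssubsets
    (fun I => subsetCumulant m₀ m₁ I * m₁ (J \ I))]

lemma cumulantSeq_eq (φ : ℕ → ℝ) (k : ℕ) :
    cumulantSeq φ k =
      φ (k + 1) - ∑ i ∈ Finset.range k, (k.choose i : ℝ) * (cumulantSeq φ i * φ (k - i)) := by
  rw [cumulantSeq, Finset.sum_range]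

lemma cumulantConst_eq (k : ℕ) :
    cumulantConst k = 1 + ∑ i ∈ Finset.range k, (k.choose i : ℝ) * cumulantConst i := by
  rw [cumulantConst, Finset.sum_range]

lemma sum_ssubsets_card (J : Finset α) (φ : ℕ → ℝ) :
    ∑ I ∈ J.ssubsets, φ I.card = ∑ i ∈ Finset.range J.card, (J.card.choose i : ℝ) * φ i := by
  have h1 := Finset.sum_powerset_apply_card φ (x := J)
  rw [Finset.sum_range_succ, ← Finset.insert_erase (Finset.mem_powerset_self J),
    Finset.sum_insert (Finset.notMem_erase _ _)] at h1
  simp only [nsmul_eq_mul, Nat.choose_self, Nat.cast_one, one_mul] at h1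
  have h2 : J.ssubsets = J.powerset.erase J := rfl
  rw [h2]
  linarith

lemma subsetCumulant_of_card (φ : ℕ → ℝ) (J : Finset α) :
    subsetCumulant (fun J : Finset α => φ (J.card + 1)) (fun J => φ J.card) J
      = cumulantSeq φ J.card := by
  induction J using Finset.strongInduction with
  | H J ih =>
    rw [subsetCumulant_eq, cumulantSeq_eq,
      ← sum_ssubsets_card J fun i => cumulantSeq φ i * φ (J.card - i)]
    congr 1
    refine Finset.sum_congr rfl fun I hI => ?_
    have hI' := Finset.mem_ssubsets.1 hI
    rw [ih I hI', Finset.card_sdiff_of_subset hI'.1]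

lemma subsetCumulant_linear_left {m₀ m₀' m₀'' m₁ : Finset α → ℝ} {r r' : ℝ}
    (h : ∀ J, m₀'' J = r * m₀ J + r' * m₀' J) (J : Finset α) :
    subsetCumulant m₀'' m₁ J = r * subsetCumulant m₀ m₁ J + r' * subsetCumulant m₀' m₁ J := by
  induction J using Finset.strongInduction with
  | H J ih =>
    rw [subsetCumulant_eq m₀'', subsetCumulant_eq m₀, subsetCumulant_eq m₀', h,
      Finset.sum_congr rfl fun I hI => by rw [ih I (Finset.mem_ssubsets.1 hI)]]
    simp only [add_mul, Finset.sum_add_distrib, mul_assoc, ← Finset.mul_sum]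
    ring

lemma subsetCumulant_congr {m₀ m₀' m₁ m₁' : Finset α → ℝ} {J : Finset α}
    (h₀ : ∀ I ⊆ J, m₀ I = m₀' I) (h₁ : ∀ I ⊆ J, m₁ I = m₁' I) :
    subsetCumulant m₀ m₁ J = subsetCumulant m₀' m₁' J := by
  induction J using Finset.strongInduction with
  | H J ih =>
    rw [subsetCumulant_eq m₀, subsetCumulant_eq m₀', h₀ J subset_rfl]
    congr 1
    refine Finset.sum_congr rfl fun I hI => ?_
    have hI' := Finset.mem_ssubsets.1 hI
    rw [h₁ _ Finset.sdiff_subset, ih I hI' (fun I' h => h₀ I' (h.trans hI'.1))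
      (fun I' h => h₁ I' (h.trans hI'.1))]

lemma subsetCumulant_linear {m₀ m₀' m₀'' m₁ m₁' m₁'' : Finset α → ℝ} {r r' : ℝ} {i : α}
    (h₀ : ∀ J, i ∉ J → m₀ J = m₀'' J) (h₀' : ∀ J, i ∉ J → m₀' J = m₀'' J)
    (h₁ : ∀ J, i ∉ J → m₁ J = m₁'' J) (h₁' : ∀ J, i ∉ J → m₁' J = m₁'' J)
    (hl₀ : ∀ J, i ∈ J → m₀'' J = r * m₀ J + r' * m₀' J)
    (hl₁ : ∀ J, i ∈ J → m₁'' J = r * m₁ J + r' * m₁' J) {J : Finset α} (hiJ : i ∈ J) :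
    subsetCumulant m₀'' m₁'' J =
      r * subsetCumulant m₀ m₁ J + r' * subsetCumulant m₀' m₁' J := by
  induction J using Finset.strongInduction with
  | H J ih =>
    rw [subsetCumulant_eq m₀'', subsetCumulant_eq m₀, subsetCumulant_eq m₀', hl₀ J hiJ]
    have key : ∀ I ∈ J.ssubsets, subsetCumulant m₀'' m₁'' I * m₁'' (J \ I)
        = r * (subsetCumulant m₀ m₁ I * m₁ (J \ I))
          + r' * (subsetCumulant m₀' m₁' I * m₁' (J \ I)) := by
      intro I hI
      have hI' := Finset.mem_ssubsets.1 hI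
      by_cases hiI : i ∈ I
      · have hn : i ∉ J \ I := fun h => (Finset.mem_sdiff.1 h).2 hiI
        rw [ih I hI' hiI, h₁ _ hn, h₁' _ hn]
        ring
      · have hn : i ∈ J \ I := Finset.mem_sdiff.2 ⟨hiJ, hiI⟩
        have e : subsetCumulant m₀ m₁ I = subsetCumulant m₀'' m₁'' I :=
          subsetCumulant_congr (fun I' h => h₀ I' fun hh => hiI (h hh))
            (fun I' h => h₁ I' fun hh => hiI (h hh))
        have e' : subsetCumulant m₀' m₁' I = subsetCumulant m₀'' m₁'' I :=
          subsetCumulant_congr (fun I' h => h₀' I' fun hh => hiI (h hh))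
            (fun I' h => h₁' I' fun hh => hiI (h hh))
        rw [hl₁ _ hn, e, e']
        ring
    rw [Finset.sum_congr rfl key, Finset.sum_add_distrib, ← Finset.mul_sum, ← Finset.mul_sum]
    ring

lemma subsetCumulant_sum_powerset {m₀ m₁ : Finset α → ℝ} (h1 : m₁ ∅ = 1) (J : Finset α) :
    ∑ I ∈ J.powerset, subsetCumulant m₀ m₁ I * m₁ (J \ I) = m₀ J := by
  rw [← Finset.insert_erase (Finset.mem_powerset_self J),
    Finset.sum_insert (Finset.notMem_erase _ _), sdiff_self, Finset.bot_eq_empty, h1, mul_one,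
    subsetCumulant_eq m₀ m₁ J]
  have h2 : J.ssubsets = J.powerset.erase J := rfl
  rw [h2]
  ring

/-- Joint cumulants vanish if the moments factorize along a splitting of the variables. -/
lemma subsetCumulant_eq_zero_of_factor {m₀ m₁ : Finset α → ℝ} {V : Finset α} (he : m₁ ∅ = 1)
    (h₀ : ∀ J, m₀ J = m₀ (J \ V) * m₁ (J ∩ V)) (h₁ : ∀ J, m₁ J = m₁ (J \ V) * m₁ (J ∩ V))
    {J : Finset α} (hJ : (J ∩ V).Nonempty) : subsetCumulant m₀ m₁ J = 0 := by
  induction J using Finset.strongInduction with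
  | H J ih =>
    have hss : J \ V ⊂ J := by
      obtain ⟨i, hi⟩ := hJ
      refine Finset.ssubset_iff_subset_ne.2 ⟨Finset.sdiff_subset, fun h => ?_⟩
      rw [← h] at hi
      exact (Finset.mem_sdiff.1 (Finset.mem_inter.1 hi).1).2 (Finset.mem_inter.1 hi).2
    have hsub : (J \ V).powerset ⊆ J.ssubsets := fun I hI =>
      Finset.mem_ssubsets.2 (lt_of_le_of_lt (Finset.mem_powerset.1 hI) hss)
    rw [subsetCumulant_eq, ← Finset.sum_subset hsub]
    · have e : ∀ I ∈ (J \ V).powerset, subsetCumulant m₀ m₁ I * m₁ (J \ I)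
          = (subsetCumulant m₀ m₁ I * m₁ ((J \ V) \ I)) * m₁ (J ∩ V) := by
        intro I hI
        have hI' := Finset.mem_powerset.1 hI
        rw [h₁ (J \ I)]
        have e1 : (J \ I) \ V = (J \ V) \ I := sdiff_right_comm _ _ _
        have e2 : (J \ I) ∩ V = J ∩ V := by
          ext i
          simp only [Finset.mem_inter, Finset.mem_sdiff]
          constructor
          · rintro ⟨⟨h1, _⟩, h2⟩
            exact ⟨h1, h2⟩
          · rintro ⟨h1, h2⟩
            exact ⟨⟨h1, fun h => (Finset.mem_sdiff.1 (hI' h)).2 h2⟩, h2⟩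
        rw [e1, e2]
        ring
      rw [Finset.sum_congr rfl e, ← Finset.sum_mul, h₀ J, subsetCumulant_sum_powerset he]
      ring
    · intro I hI hIn
      have hI' := Finset.mem_ssubsets.1 hI
      rw [ih I hI', zero_mul]
      by_contra hne
      rw [Finset.not_nonempty_iff_eq_empty] at hne
      refine hIn (Finset.mem_powerset.2 fun i hi => Finset.mem_sdiff.2 ⟨hI'.1 hi, fun hV => ?_⟩)
      exact Finset.notMem_empty i (hne ▸ Finset.mem_inter.2 ⟨hi, hV⟩)

lemma cumulantConst_nonneg (k : ℕ) : 0 ≤ cumulantConst k := by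
  induction k using Nat.strong_induction_on with
  | _ k ih =>
    rw [cumulantConst_eq]
    have : 0 ≤ ∑ i ∈ Finset.range k, (k.choose i : ℝ) * cumulantConst i :=
      Finset.sum_nonneg fun i hi => mul_nonneg (by positivity) (ih i (Finset.mem_range.1 hi))
    linarith

lemma abs_subsetCumulant_le {m₀ m₁ : Finset α → ℝ} {w : ℕ → ℝ}
    (hw : ∀ a b, w a * w b ≤ w (a + b)) (hw0 : ∀ a, 0 ≤ w a)
    (h₀ : ∀ J, |m₀ J| ≤ w (J.card + 1)) (h₁ : ∀ J, |m₁ J| ≤ w J.card) (J : Finset α) :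
    |subsetCumulant m₀ m₁ J| ≤ cumulantConst J.card * w (J.card + 1) := by
  induction J using Finset.strongInduction with
  | H J ih =>
    rw [subsetCumulant_eq, cumulantConst_eq, ← sum_ssubsets_card, add_mul, one_mul, Finset.sum_mul]
    refine (abs_sub _ _).trans (add_le_add (h₀ J) ((Finset.abs_sum_le_sum_abs _ _).trans
      (Finset.sum_le_sum fun I hI => ?_)))
    have hI' := Finset.mem_ssubsets.1 hI
    have hc : I.card + 1 + (J \ I).card = J.card + 1 := by
      rw [← Finset.card_sdiff_add_card_eq_card hI'.1]
      ring
    rw [abs_mul]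
    calc _ ≤ (cumulantConst I.card * w (I.card + 1)) * w (J \ I).card :=
          mul_le_mul (ih I hI') (h₁ _) (abs_nonneg _)
            (mul_nonneg (cumulantConst_nonneg _) (hw0 _))
      _ = cumulantConst I.card * (w (I.card + 1) * w (J \ I).card) := by ring
      _ ≤ _ := by
        rw [← hc]
        exact mul_le_mul_of_nonneg_left (hw _ _) (cumulantConst_nonneg _)

/-- Stability of joint cumulants under perturbations of the moments. -/
lemma abs_subsetCumulant_sub_le {m₀ m₁ g₀ g₁ : Finset α → ℝ} {w : ℕ → ℝ}
    {ψ₀ ψ₁ : Finset α → ℝ}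
    (hw : ∀ a b, w a * w b ≤ w (a + b)) (hw0 : ∀ a, 0 ≤ w a)
    (h₁ : ∀ J, |m₁ J| ≤ w J.card)
    (hg₀ : ∀ J, |g₀ J| ≤ w (J.card + 1)) (hg₁ : ∀ J, |g₁ J| ≤ w J.card)
    (hd₀ : ∀ J, |m₀ J - g₀ J| ≤ ψ₀ J * w (J.card + 1))
    (hd₁ : ∀ J, |m₁ J - g₁ J| ≤ ψ₁ J * w J.card)
    (hψ₀ : ∀ J, 0 ≤ ψ₀ J)
    (hψ : ∀ I J, I ⊆ J → ψ₀ I + ψ₁ (J \ I) ≤ ψ₀ J) (J : Finset α) :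
    |subsetCumulant m₀ m₁ J - subsetCumulant g₀ g₁ J|
      ≤ cumulantConst J.card * (ψ₀ J * w (J.card + 1)) := by
  induction J using Finset.strongInduction with
  | H J ih =>
    rw [subsetCumulant_eq m₀, subsetCumulant_eq g₀, cumulantConst_eq, ← sum_ssubsets_card,
      add_mul, one_mul, Finset.sum_mul]
    have e : ∀ x y z t : ℝ, x - y - (z - t) = (x - z) - (y - t) := fun x y z t => by ring
    rw [e, ← Finset.sum_sub_distrib]
    refine (abs_sub _ _).trans (add_le_add (hd₀ J) ((Finset.abs_sum_le_sum_abs _ _).trans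
      (Finset.sum_le_sum fun I hI => ?_)))
    have hI' := Finset.mem_ssubsets.1 hI
    have hc : I.card + 1 + (J \ I).card = J.card + 1 := by
      rw [← Finset.card_sdiff_add_card_eq_card hI'.1]
      ring
    have hC := cumulantConst_nonneg I.card
    have e2 : subsetCumulant m₀ m₁ I * m₁ (J \ I) - subsetCumulant g₀ g₁ I * g₁ (J \ I)
        = (subsetCumulant m₀ m₁ I - subsetCumulant g₀ g₁ I) * m₁ (J \ I)
          + subsetCumulant g₀ g₁ I * (m₁ (J \ I) - g₁ (J \ I)) := by ring
    rw [e2]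
    refine (abs_add_le _ _).trans ?_
    rw [abs_mul, abs_mul]
    calc _ ≤ (cumulantConst I.card * (ψ₀ I * w (I.card + 1))) * w (J \ I).card
          + (cumulantConst I.card * w (I.card + 1)) * (ψ₁ (J \ I) * w (J \ I).card) := by
          refine add_le_add ?_ ?_
          · exact mul_le_mul (ih I hI') (h₁ _) (abs_nonneg _)
              (mul_nonneg hC (mul_nonneg (hψ₀ _) (hw0 _)))
          · exact mul_le_mul (abs_subsetCumulant_le hw hw0 hg₀ hg₁ I) (hd₁ _) (abs_nonneg _)
              (mul_nonneg hC (hw0 _))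
      _ = cumulantConst I.card * ((ψ₀ I + ψ₁ (J \ I)) * (w (I.card + 1) * w (J \ I).card)) := by
          ring
      _ ≤ cumulantConst I.card * (ψ₀ J * w (J.card + 1)) := by
          refine mul_le_mul_of_nonneg_left ?_ hC
          refine mul_le_mul (hψ I J hI'.1) ?_ (mul_nonneg (hw0 _) (hw0 _)) (hψ₀ J)
          rw [← hc]
          exact hw _ _

end SubsetCumulant

lemma cumulantConst_le (k : ℕ) :
    cumulantConst k ≤ (Nat.factorial k : ℝ) * (16 / 11) ^ (k + 1) := by
  have c0 : cumulantConst 0 = 1 := by simp [cumulantConst_eq 0]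
  have c1 : cumulantConst 1 = 2 := by
    rw [cumulantConst_eq]
    norm_num [Finset.sum_range_succ, c0]
  have c2 : cumulantConst 2 = 6 := by
    rw [cumulantConst_eq]
    norm_num [Finset.sum_range_succ, c0, c1, Nat.choose]
  have c3 : cumulantConst 3 = 26 := by
    rw [cumulantConst_eq]
    norm_num [Finset.sum_range_succ, c0, c1, c2, Nat.choose]
  have key : ∀ k : ℕ, 4 ≤ k → (11 / 16 : ℝ) ^ (k + 1) / (Nat.factorial k : ℝ)
      + ∑ i ∈ Finset.range k, (11 / 16 : ℝ) ^ (i + 1) / (Nat.factorial (i + 1) : ℝ) ≤ 1 := by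
    intro k hk
    induction k, hk using Nat.le_induction with
    | base => norm_num [Finset.sum_range_succ, Nat.factorial]
    | succ k hk ih =>
      refine le_trans ?_ ih
      rw [Finset.sum_range_succ, Nat.factorial_succ]
      have hk' : (4 : ℝ) ≤ k := by exact_mod_cast hk
      have hf : (0 : ℝ) < (Nat.factorial k : ℝ) := by positivity
      have e : (11 / 16 : ℝ) ^ (k + 1) / (Nat.factorial k : ℝ)
          = (11 / 16 : ℝ) ^ (k + 1) / (((k + 1) * Nat.factorial k : ℝ)) * (k + 1) := by
        field_simp
      have hp : (0 : ℝ) < (11 / 16 : ℝ) ^ (k + 1) / (((k + 1) * Nat.factorial k : ℝ)) := by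
        positivity
      push_cast
      rw [e, pow_succ (11 / 16 : ℝ) (k + 1), mul_div_right_comm]
      nlinarith
  induction k using Nat.strong_induction_on with
  | _ k ih =>
    by_cases hk : 4 ≤ k
    · rw [cumulantConst_eq]
      have hstep : ∑ i ∈ Finset.range k, (k.choose i : ℝ) * cumulantConst i
          ≤ (Nat.factorial k : ℝ) * (16 / 11) ^ (k + 1) *
            ∑ i ∈ Finset.range k, (11 / 16 : ℝ) ^ (i + 1) / (Nat.factorial (i + 1) : ℝ) := by
        rw [← Finset.sum_range_reflect, Finset.mul_sum]
        refine Finset.sum_le_sum fun i hi => ?_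
        have hik := Finset.mem_range.1 hi
        obtain ⟨j, rfl⟩ : ∃ j, k = j + i + 1 := ⟨k - i - 1, by omega⟩
        have hj : j + i + 1 - 1 - i = j := by omega
        rw [hj]
        refine (mul_le_mul_of_nonneg_left (ih j (by omega)) (by positivity)).trans (le_of_eq ?_)
        have hjj : j + i + 1 - j = i + 1 := by omega
        rw [Nat.cast_choose ℝ (show j ≤ j + i + 1 by omega), hjj]
        have h1 : (Nat.factorial j : ℝ) ≠ 0 := by positivity
        have e : (16 / 11 : ℝ) ^ (j + i + 1 + 1) = (16 / 11) ^ (j + 1) * (16 / 11) ^ (i + 1) := by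
          ring
        have e2 : (16 / 11 : ℝ) ^ (i + 1) * (11 / 16) ^ (i + 1) = 1 := by
          rw [← mul_pow]
          norm_num
        rw [e]
        calc _ = (Nat.factorial (j + i + 1) : ℝ) * (16 / 11) ^ (j + 1) * 1
              / (Nat.factorial (i + 1) : ℝ) := by field_simp
          _ = _ := by rw [← e2]; ring
      have e1 : (1 : ℝ) = (Nat.factorial k : ℝ) * (16 / 11) ^ (k + 1) *
          ((11 / 16 : ℝ) ^ (k + 1) / (Nat.factorial k : ℝ)) := by
        have h1 : (Nat.factorial k : ℝ) ≠ 0 := by positivity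
        have e2 : (16 / 11 : ℝ) ^ (k + 1) * (11 / 16) ^ (k + 1) = 1 := by
          rw [← mul_pow]
          norm_num
        field_simp
        linarith
      calc _ ≤ (Nat.factorial k : ℝ) * (16 / 11) ^ (k + 1) *
            ((11 / 16 : ℝ) ^ (k + 1) / (Nat.factorial k : ℝ)
            + ∑ i ∈ Finset.range k, (11 / 16 : ℝ) ^ (i + 1) / (Nat.factorial (i + 1) : ℝ)) := by
            rw [mul_add, ← e1]
            linarith
        _ ≤ _ := mul_le_of_le_one_right (by positivity) (key k hk)
    · interval_cases k
      · rw [c0]; norm_num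
      · rw [c1]; norm_num
      · rw [c2]; norm_num [Nat.factorial]
      · rw [c3]; norm_num [Nat.factorial]

section JointCumulant

variable {R : Type*} [CommRing R] [Algebra ℝ R]

/-- The joint cumulant of `Y 0, …, Y k` with respect to the expectation functional `E`. -/
noncomputable def jointCumulant (E : R →ₗ[ℝ] ℝ) {k : ℕ} (Y : Fin (k + 1) → R) : ℝ :=
  subsetCumulant (fun J : Finset (Fin k) => E (Y 0 * ∏ i ∈ J, Y i.succ))
    (fun J => E (∏ i ∈ J, Y i.succ)) Finset.univ

lemma jointCumulant_update_linear (E : R →ₗ[ℝ] ℝ) {k : ℕ} (Y : Fin (k + 1) → R)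
    (i : Fin (k + 1)) (r r' : ℝ) (x y : R) :
    jointCumulant E (Function.update Y i (r • x + r' • y))
      = r * jointCumulant E (Function.update Y i x)
        + r' * jointCumulant E (Function.update Y i y) := by
  unfold jointCumulant
  refine Fin.cases ?_ (fun i => ?_) i
  · simp only [Function.update_self, Function.update_of_ne (Fin.succ_ne_zero _)]
    refine subsetCumulant_linear_left (fun J => ?_) _
    simp only [add_mul, smul_mul_assoc, map_add, map_smul, smul_eq_mul]
  · have h0 : ∀ z, Function.update Y i.succ z 0 = Y 0 := fun z =>
      Function.update_of_ne (Fin.succ_ne_zero i).symm _ _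
    have hout : ∀ z, ∀ J : Finset (Fin k), i ∉ J →
        ∏ j ∈ J, Function.update Y i.succ z j.succ = ∏ j ∈ J, Y j.succ := by
      intro z J hJ
      refine Finset.prod_congr rfl fun j hj => Function.update_of_ne ?_ _ _
      rintro h
      exact hJ (Fin.succ_injective _ h ▸ hj)
    have hin : ∀ z, ∀ J : Finset (Fin k), i ∈ J →
        ∏ j ∈ J, Function.update Y i.succ z j.succ = z * ∏ j ∈ J.erase i, Y j.succ := by
      intro z J hJ
      rw [← Finset.mul_prod_erase _ _ hJ, Function.update_self,
        hout z _ (Finset.notMem_erase _ _)]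
    simp only [h0]
    refine subsetCumulant_linear (i := i) ?_ ?_ ?_ ?_ ?_ ?_ (Finset.mem_univ i)
    · intro J hJ
      rw [hout _ J hJ, hout _ J hJ]
    · intro J hJ
      rw [hout _ J hJ, hout _ J hJ]
    · intro J hJ
      rw [hout _ J hJ, hout _ J hJ]
    · intro J hJ
      rw [hout _ J hJ, hout _ J hJ]
    · intro J hJ
      simp only [hin _ J hJ, add_mul, mul_add, smul_mul_assoc, mul_smul_comm, map_add, map_smul,
        smul_eq_mul]
    · intro J hJ
      simp only [hin _ J hJ, add_mul, smul_mul_assoc, map_add, map_smul, smul_eq_mul]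

/-- The joint cumulant as a multilinear map. -/
noncomputable def jointCumulantMultilinear (E : R →ₗ[ℝ] ℝ) (k : ℕ) :
    MultilinearMap ℝ (fun _ : Fin (k + 1) => R) ℝ where
  toFun Y := jointCumulant E Y
  map_update_add' {inst} Y i x y := by
    obtain rfl : inst = instDecidableEqFin (k + 1) := Subsingleton.elim _ _
    simpa using jointCumulant_update_linear E Y i 1 1 x y
  map_update_smul' {inst} Y i c x := by
    obtain rfl : inst = instDecidableEqFin (k + 1) := Subsingleton.elim _ _
    simpa using jointCumulant_update_linear E Y i c 0 x x

lemma jointCumulant_const (E : R →ₗ[ℝ] ℝ) (k : ℕ) (S : R) :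
    jointCumulant E (fun _ : Fin (k + 1) => S) = cumulantSeq (fun j => E (S ^ j)) k := by
  have h := subsetCumulant_of_card (fun j => E (S ^ j)) (Finset.univ : Finset (Fin k))
  rw [Finset.card_fin] at h
  rw [← h]
  simp [jointCumulant, pow_succ']

/-- The cumulant of a sum is the sum of all joint cumulants of the summands. -/
lemma cumulantSeq_sum {ι : Type*} [Fintype ι] (E : R →ₗ[ℝ] ℝ) (k : ℕ) (X : ι → R) :
    cumulantSeq (fun j => E ((∑ i, X i) ^ j)) k
      = ∑ t : Fin (k + 1) → ι, jointCumulant E (fun i => X (t i)) := by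
  classical
  rw [← jointCumulant_const]
  exact (jointCumulantMultilinear E k).map_sum (fun _ i => X i)

end JointCumulant

lemma abs_subsetCumulant_le_of_approx_factor {α : Type*} [DecidableEq α]
    {m₀ m₁ : Finset α → ℝ} {w : ℕ → ℝ} {Ψ : ℕ → ℕ → ℝ} {D : ℝ} (hD : 0 ≤ D)
    (hw : ∀ a b, w a * w b ≤ w (a + b)) (hw0 : ∀ a, 0 ≤ w a)
    (hΨ0 : ∀ u v, 0 ≤ Ψ u v) (hΨ : ∀ u v u' v', Ψ u v + Ψ u' v' ≤ Ψ (u + u') (v + v'))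
    (he : m₁ ∅ = 1) (h₀ : ∀ J, |m₀ J| ≤ w (J.card + 1)) (h₁ : ∀ J, |m₁ J| ≤ w J.card)
    {V : Finset α}
    (hd₀ : ∀ J, |m₀ J - m₀ (J \ V) * m₁ (J ∩ V)|
      ≤ D * Ψ ((J \ V).card + 1) (J ∩ V).card * w (J.card + 1))
    (hd₁ : ∀ J, |m₁ J - m₁ (J \ V) * m₁ (J ∩ V)|
      ≤ D * Ψ (J \ V).card (J ∩ V).card * w J.card)
    {J : Finset α} (hJ : (J ∩ V).Nonempty) :
    |subsetCumulant m₀ m₁ J| ≤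
      cumulantConst J.card * (D * Ψ ((J \ V).card + 1) (J ∩ V).card * w (J.card + 1)) := by
  have hcard : ∀ J : Finset α, (J \ V).card + (J ∩ V).card = J.card := fun J =>
    Finset.card_sdiff_add_card_inter J V
  have hz : subsetCumulant (fun J => m₀ (J \ V) * m₁ (J ∩ V))
      (fun J => m₁ (J \ V) * m₁ (J ∩ V)) J = 0 := by
    have e1 : ∀ J : Finset α, (J \ V) \ V = J \ V := fun J => by simp
    have e2 : ∀ J : Finset α, (J \ V) ∩ V = ∅ := fun J => by simp
    have e3 : ∀ J : Finset α, (J ∩ V) \ V = ∅ := fun J => by simp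
    have e4 : ∀ J : Finset α, (J ∩ V) ∩ V = J ∩ V := fun J => by simp
    refine subsetCumulant_eq_zero_of_factor (V := V) ?_ ?_ ?_ hJ
    · simp [he]
    · intro J
      simp only [e1, e2, e3, e4, he]
      ring
    · intro J
      simp only [e1, e2, e3, e4, he]
      ring
  have h := abs_subsetCumulant_sub_le (m₀ := m₀) (m₁ := m₁)
    (g₀ := fun J => m₀ (J \ V) * m₁ (J ∩ V)) (g₁ := fun J => m₁ (J \ V) * m₁ (J ∩ V)) (w := w)
    (ψ₀ := fun J => D * Ψ ((J \ V).card + 1) (J ∩ V).card)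
    (ψ₁ := fun J => D * Ψ (J \ V).card (J ∩ V).card) hw hw0 h₁ ?_ ?_ hd₀ hd₁
    (fun J => mul_nonneg hD (hΨ0 _ _)) ?_ J
  · rwa [hz, sub_zero] at h
  · intro J
    rw [abs_mul]
    refine (mul_le_mul (h₀ _) (h₁ _) (abs_nonneg _) (hw0 _)).trans ((hw _ _).trans_eq ?_)
    rw [← hcard J]
    ring_nf
  · intro J
    rw [abs_mul]
    refine (mul_le_mul (h₁ _) (h₁ _) (abs_nonneg _) (hw0 _)).trans ((hw _ _).trans_eq ?_)
    rw [hcard J]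
  · intro I J hIJ
    rw [← mul_add]
    refine mul_le_mul_of_nonneg_left ((hΨ _ _ _ _).trans_eq ?_) hD
    have c1 : (I \ V).card + 1 + ((J \ I) \ V).card = (J \ V).card + 1 := by
      rw [sdiff_right_comm, ← Finset.card_sdiff_add_card_eq_card (s := I \ V) (t := J \ V)
        (Finset.sdiff_subset_sdiff hIJ subset_rfl)]
      have : (J \ V) \ (I \ V) = (J \ V) \ I := by
        ext i
        simp only [Finset.mem_sdiff]
        tauto
      rw [this]
      ring
    have c2 : (I ∩ V).card + ((J \ I) ∩ V).card = (J ∩ V).card := by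
      rw [← Finset.card_sdiff_add_card_eq_card (s := I ∩ V) (t := J ∩ V)
        (Finset.inter_subset_inter hIJ subset_rfl)]
      have : (J ∩ V) \ (I ∩ V) = (J \ I) ∩ V := by
        ext i
        simp only [Finset.mem_sdiff, Finset.mem_inter]
        tauto
      rw [this]
      ring
    rw [c1, c2]

/-- If the moments `f` almost factorize along the splitting `U`, `Uᶜ`, the joint cumulant of all
variables is small. -/
lemma abs_subsetCumulant_le_of_split {k : ℕ} {f : Finset (Fin (k + 1)) → ℝ} {w : ℕ → ℝ}
    {Ψ : ℕ → ℕ → ℝ} {D : ℝ} (hD : 0 ≤ D)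
    (hw : ∀ a b, w a * w b ≤ w (a + b)) (hw0 : ∀ a, 0 ≤ w a)
    (hΨ0 : ∀ u v, 0 ≤ Ψ u v) (hΨ : ∀ u v u' v', Ψ u v + Ψ u' v' ≤ Ψ (u + u') (v + v'))
    (he : f ∅ = 1) (hf : ∀ B, |f B| ≤ w B.card) {U : Finset (Fin (k + 1))}
    (hsplit : ∀ B₁ B₂, B₁ ⊆ U → Disjoint B₂ U →
      |f (B₁ ∪ B₂) - f B₁ * f B₂| ≤ D * Ψ B₁.card B₂.card * w (B₁.card + B₂.card))
    (hU : U.Nonempty) (hU' : U ≠ Finset.univ) :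
    |subsetCumulant (fun J : Finset (Fin k) => f (insert 0 (J.map (Fin.succEmb k))))
        (fun J => f (J.map (Fin.succEmb k))) Finset.univ|
      ≤ cumulantConst k * (D * Ψ U.card (k + 1 - U.card) * w (k + 1)) := by
  have hmem0 : ∀ J : Finset (Fin k), (0 : Fin (k + 1)) ∉ J.map (Fin.succEmb k) := by
    intro J h
    obtain ⟨i, _, hi⟩ := Finset.mem_map.1 h
    exact Fin.succ_ne_zero i hi
  have hcard0 : ∀ J : Finset (Fin k),
      (insert 0 (J.map (Fin.succEmb k))).card = J.card + 1 := fun J => by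
    rw [Finset.card_insert_of_notMem (hmem0 J), Finset.card_map]
  have hsd : ∀ (J V : Finset (Fin k)), (J \ V).map (Fin.succEmb k) ∪ (J ∩ V).map (Fin.succEmb k)
      = J.map (Fin.succEmb k) := by
    intro J V
    rw [← Finset.map_union, Finset.sdiff_union_inter]
  have hcards : ∀ J V : Finset (Fin k), (J \ V).card + (J ∩ V).card = J.card := fun J V =>
    Finset.card_sdiff_add_card_inter J V
  by_cases h0 : (0 : Fin (k + 1)) ∈ U
  · set V : Finset (Fin k) := Finset.univ.filter fun i => i.succ ∉ U with hV
    have hlow : ∀ J : Finset (Fin k), (J \ V).map (Fin.succEmb k) ⊆ U := by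
      intro J i hi
      obtain ⟨j, hj, rfl⟩ := Finset.mem_map.1 hi
      by_contra h
      exact (Finset.mem_sdiff.1 hj).2 (Finset.mem_filter.2 ⟨Finset.mem_univ _, h⟩)
    have hlow0 : ∀ J : Finset (Fin k), insert 0 ((J \ V).map (Fin.succEmb k)) ⊆ U := fun J =>
      Finset.insert_subset h0 (hlow J)
    have hup : ∀ J : Finset (Fin k), Disjoint ((J ∩ V).map (Fin.succEmb k)) U := by
      intro J
      refine Finset.disjoint_left.2 fun i hi => ?_
      obtain ⟨j, hj, rfl⟩ := Finset.mem_map.1 hi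
      exact (Finset.mem_filter.1 (Finset.mem_inter.1 hj).2).2
    have hUeq : insert 0 ((Finset.univ \ V).map (Fin.succEmb k)) = U := by
      refine Finset.Subset.antisymm (hlow0 _) fun i hi => ?_
      refine Fin.cases (fun _ => Finset.mem_insert_self _ _) (fun j hj => ?_) i hi
      refine Finset.mem_insert_of_mem (Finset.mem_map.2 ⟨j, ?_, rfl⟩)
      simp [hV, hj]
    have hUcard : (Finset.univ \ V).card + 1 = U.card := by
      rw [← hcard0, hUeq]
    have hVcard : (Finset.univ ∩ V).card = k + 1 - U.card := by
      have := hcards Finset.univ V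
      rw [Finset.card_fin] at this
      omega
    have hne : (Finset.univ ∩ V).Nonempty := by
      rw [← Finset.card_pos, hVcard]
      have := Finset.card_lt_card (Finset.ssubset_univ_iff.2 hU')
      rw [Finset.card_fin] at this
      omega
    have h := abs_subsetCumulant_le_of_approx_factor
      (m₀ := fun J : Finset (Fin k) => f (insert 0 (J.map (Fin.succEmb k))))
      (m₁ := fun J => f (J.map (Fin.succEmb k))) hD hw hw0 hΨ0 hΨ (by simpa using he)
      (fun J => by rw [← hcard0]; exact hf _)
      (fun J => by simpa using hf (J.map (Fin.succEmb k))) (V := V) ?_ ?_ hne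
    · rwa [hUcard, hVcard, Finset.card_fin] at h
    · intro J
      have h := hsplit _ _ (hlow0 J) (hup J)
      rw [Finset.insert_union, hsd, hcard0, Finset.card_map, add_right_comm, hcards] at h
      exact h
    · intro J
      have h := hsplit _ _ (hlow J) (hup J)
      rw [hsd, Finset.card_map, Finset.card_map, hcards] at h
      exact h
  · set V : Finset (Fin k) := Finset.univ.filter fun i => i.succ ∈ U with hV
    have hup : ∀ J : Finset (Fin k), Disjoint ((J \ V).map (Fin.succEmb k)) U := by
      intro J
      refine Finset.disjoint_left.2 fun i hi h => ?_
      obtain ⟨j, hj, rfl⟩ := Finset.mem_map.1 hi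
      exact (Finset.mem_sdiff.1 hj).2 (Finset.mem_filter.2 ⟨Finset.mem_univ _, h⟩)
    have hup0 : ∀ J : Finset (Fin k), Disjoint (insert 0 ((J \ V).map (Fin.succEmb k))) U :=
      fun J => Finset.disjoint_insert_left.2 ⟨h0, hup J⟩
    have hlow : ∀ J : Finset (Fin k), (J ∩ V).map (Fin.succEmb k) ⊆ U := by
      intro J i hi
      obtain ⟨j, hj, rfl⟩ := Finset.mem_map.1 hi
      exact (Finset.mem_filter.1 (Finset.mem_inter.1 hj).2).2
    have hUeq : (Finset.univ ∩ V).map (Fin.succEmb k) = U := by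
      refine Finset.Subset.antisymm (hlow _) fun i hi => ?_
      refine Fin.cases (fun h => absurd h h0) (fun j hj => ?_) i hi
      refine Finset.mem_map.2 ⟨j, ?_, rfl⟩
      simp [hV, hj]
    have hUcard : (Finset.univ ∩ V).card = U.card := by
      rw [← Finset.card_map (Fin.succEmb k), hUeq]
    have hVcard : (Finset.univ \ V).card + 1 = k + 1 - U.card := by
      have := hcards Finset.univ V
      rw [Finset.card_fin] at this
      omega
    have hne : (Finset.univ ∩ V).Nonempty := by
      rw [← Finset.card_pos, hUcard]
      exact hU.card_pos
    have h := abs_subsetCumulant_le_of_approx_factor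
      (m₀ := fun J : Finset (Fin k) => f (insert 0 (J.map (Fin.succEmb k))))
      (m₁ := fun J => f (J.map (Fin.succEmb k))) (Ψ := fun u v => Ψ v u) hD hw hw0
      (fun u v => hΨ0 v u) (fun u v u' v' => hΨ v u v' u') (by simpa using he)
      (fun J => by rw [← hcard0]; exact hf _)
      (fun J => by simpa using hf (J.map (Fin.succEmb k))) (V := V) ?_ ?_ hne
    · rwa [hUcard, hVcard, Finset.card_fin] at h
    · intro J
      have h := hsplit _ _ (hlow J) (hup0 J)
      rw [Finset.union_insert, Finset.union_comm, hsd, hcard0, Finset.card_map,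
        add_comm (J ∩ V).card, add_right_comm, hcards, mul_comm (f _)] at h
      exact h
    · intro J
      have h := hsplit _ _ (hlow J) (hup J)
      rw [Finset.union_comm, hsd, Finset.card_map, Finset.card_map, add_comm (J ∩ V).card,
        hcards, mul_comm (f _)] at h
      exact h

/-- The gap between two consecutive entries of a tuple. -/
def tupleGap {m n : ℕ} (T : Fin (m + 2) → Fin n) (j : Fin (m + 1)) : ℕ :=
  (T j.succ).val - (T j.castSucc).val

lemma tupleGap_injOn {m n : ℕ} {T T' : Fin (m + 2) → Fin n} (hT : Monotone T)
    (hT' : Monotone T') (h0 : T 0 = T' 0) (hg : ∀ j, tupleGap T j = tupleGap T' j) : T = T' := by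
  funext i
  induction i using Fin.induction with
  | zero => exact h0
  | succ i ih =>
    have h1 : (T i.castSucc).val ≤ (T i.succ).val := hT (Fin.castSucc_lt_succ).le
    have h2 : (T' i.castSucc).val ≤ (T' i.succ).val := hT' (Fin.castSucc_lt_succ).le
    have h3 := hg i
    have h4 := congrArg Fin.val ih
    unfold tupleGap at h3
    exact Fin.ext (by omega)

open Classical in
/-- The number of monotone tuples with a given maximal gap at a given position. -/
lemma card_monotone_tuples_le {m n : ℕ} (j : Fin (m + 1)) (s : ℕ) :
    (Finset.univ.filter fun T : Fin (m + 2) → Fin n =>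
      (Monotone T ∧ ∀ i, tupleGap T i ≤ tupleGap T j) ∧ tupleGap T j = s).card
        ≤ n * (s + 1) ^ m := by
  have hc : ((Finset.univ : Finset (Fin n)) ×ˢ Fintype.piFinset
      (fun i : Fin (m + 1) => if i = j then {s} else Finset.range (s + 1))).card
        = n * (s + 1) ^ m := by
    rw [Finset.card_product, Finset.card_fin, Fintype.card_piFinset,
      ← Finset.mul_prod_erase _ _ (Finset.mem_univ j), if_pos rfl, Finset.card_singleton, one_mul,
      Finset.prod_congr rfl (g := fun _ => s + 1), Finset.prod_const,
      Finset.card_erase_of_mem (Finset.mem_univ j), Finset.card_fin, Nat.add_sub_cancel]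
    intro i hi
    rw [if_neg (Finset.ne_of_mem_erase hi), Finset.card_range]
  rw [← hc]
  refine Finset.card_le_card_of_injOn (fun T => (T 0, tupleGap T)) ?_ ?_
  · intro T hT
    obtain ⟨⟨_, h2⟩, h3⟩ := (Finset.mem_filter.1 hT).2
    refine Finset.mem_coe.2 (Finset.mem_product.2 ⟨Finset.mem_univ _, Fintype.mem_piFinset.2 ?_⟩)
    intro i
    dsimp only
    split_ifs with h
    · rw [h, h3]
      exact Finset.mem_singleton_self s
    · rw [Finset.mem_range, ← h3]
      exact Nat.lt_succ_of_le (h2 i)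
  · intro T hT T' hT' h
    obtain ⟨⟨h1, _⟩, _⟩ := (Finset.mem_filter.1 hT).2
    obtain ⟨⟨h1', _⟩, _⟩ := (Finset.mem_filter.1 hT').2
    rw [Prod.mk.injEq] at h
    exact tupleGap_injOn h1 h1' h.1 (congrFun h.2)

open Classical in
lemma sum_monotone_tuples_le {m n : ℕ} (C : (Fin (m + 2) → Fin n) → ℝ)
    {ψ : Fin (m + 1) → ℝ} (hψ : ∀ j, 0 ≤ ψ j) {ρ : ℕ → ℝ} (hρ : ∀ r, 0 ≤ ρ r)
    (hC : ∀ T, Monotone T → ∀ j, C T ≤ ψ j * ρ (tupleGap T j)) :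
    ∑ T : Fin (m + 2) → Fin n with Monotone T, C T
      ≤ n * (∑ j, ψ j) * ∑ s ∈ Finset.range n, ((s : ℝ) + 1) ^ m * ρ s := by
  have hstep : ∀ j : Fin (m + 1),
      ∑ T : Fin (m + 2) → Fin n with Monotone T ∧ ∀ i, tupleGap T i ≤ tupleGap T j,
        ρ (tupleGap T j) ≤ n * ∑ s ∈ Finset.range n, ((s : ℝ) + 1) ^ m * ρ s := by
    intro j
    rw [← Finset.sum_fiberwise_of_maps_to (t := Finset.range n) (g := fun T => tupleGap T j),
      Finset.mul_sum]
    · refine Finset.sum_le_sum fun s _ => ?_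
      rw [Finset.sum_congr rfl (g := fun _ => ρ s), Finset.sum_const, nsmul_eq_mul,
        Finset.filter_filter, ← mul_assoc]
      · refine mul_le_mul_of_nonneg_right ?_ (hρ s)
        exact_mod_cast card_monotone_tuples_le j s
      · intro T hT
        rw [(Finset.mem_filter.1 hT).2]
    · intro T _
      have := (T j.succ).isLt
      rw [Finset.mem_range, tupleGap]
      omega
  calc ∑ T : Fin (m + 2) → Fin n with Monotone T, C T
      ≤ ∑ T : Fin (m + 2) → Fin n with Monotone T,
          ∑ j, if ∀ i, tupleGap T i ≤ tupleGap T j then ψ j * ρ (tupleGap T j) else 0 := by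
        refine Finset.sum_le_sum fun T hT => ?_
        have hT := (Finset.mem_filter.1 hT).2
        obtain ⟨j, hj⟩ := Finite.exists_max (tupleGap T)
        refine (hC T hT j).trans ?_
        refine le_trans (le_of_eq ?_) (Finset.single_le_sum (fun i _ => ?_) (Finset.mem_univ j))
        · rw [if_pos hj]
        · split_ifs
          exacts [mul_nonneg (hψ i) (hρ _), le_rfl]
    _ = ∑ j, ψ j * ∑ T : Fin (m + 2) → Fin n with
          Monotone T ∧ ∀ i, tupleGap T i ≤ tupleGap T j, ρ (tupleGap T j) := by
        rw [Finset.sum_comm]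
        refine Finset.sum_congr rfl fun j _ => ?_
        rw [← Finset.sum_filter, Finset.filter_filter, Finset.mul_sum]
    _ ≤ ∑ j, ψ j * (n * ∑ s ∈ Finset.range n, ((s : ℝ) + 1) ^ m * ρ s) :=
        Finset.sum_le_sum fun j _ => mul_le_mul_of_nonneg_left (hstep j) (hψ j)
    _ = n * (∑ j, ψ j) * ∑ s ∈ Finset.range n, ((s : ℝ) + 1) ^ m * ρ s := by
        rw [← Finset.sum_mul]
        ring

open Classical in
/-- Summing a bound by the largest gap of the ordered tuple over all tuples. -/
lemma sum_tuples_le {m n : ℕ} {C : (Fin (m + 2) → Fin n) → ℝ} (hC0 : ∀ t, 0 ≤ C t)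
    {ψ : Fin (m + 1) → ℝ} (hψ : ∀ j, 0 ≤ ψ j) {ρ : ℕ → ℝ} (hρ : ∀ r, 0 ≤ ρ r)
    (hC : ∀ t, ∀ σ : Equiv.Perm (Fin (m + 2)), Monotone (t ∘ σ) →
      ∀ j, C t ≤ ψ j * ρ (tupleGap (t ∘ σ) j)) :
    ∑ t, C t ≤ (Nat.factorial (m + 2) : ℝ) *
      (n * (∑ j, ψ j) * ∑ s ∈ Finset.range n, ((s : ℝ) + 1) ^ m * ρ s) := by
  calc ∑ t, C t
      ≤ ∑ t : Fin (m + 2) → Fin n, ∑ σ : Equiv.Perm (Fin (m + 2)),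
          if Monotone (t ∘ σ) then C t else 0 := by
        refine Finset.sum_le_sum fun t _ => ?_
        refine le_trans (le_of_eq ?_)
          (Finset.single_le_sum (fun i _ => ?_) (Finset.mem_univ (Tuple.sort t)))
        · rw [if_pos (Tuple.monotone_sort t)]
        · split_ifs
          exacts [hC0 t, le_rfl]
    _ = ∑ σ : Equiv.Perm (Fin (m + 2)), ∑ T : Fin (m + 2) → Fin n with Monotone T,
          C (T ∘ σ.symm) := by
        rw [Finset.sum_comm]
        refine Finset.sum_congr rfl fun σ _ => ?_
        rw [Finset.sum_filter]
        refine Fintype.sum_equiv (σ.symm.arrowCongr (Equiv.refl _)) _ _ fun t => ?_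
        have h1 : σ.symm.arrowCongr (Equiv.refl _) t = t ∘ σ := rfl
        have h2 : (t ∘ σ) ∘ σ.symm = t := by
          funext i
          simp
        rw [h1, h2]
    _ ≤ ∑ σ : Equiv.Perm (Fin (m + 2)),
          n * (∑ j, ψ j) * ∑ s ∈ Finset.range n, ((s : ℝ) + 1) ^ m * ρ s := by
        refine Finset.sum_le_sum fun σ _ => ?_
        refine sum_monotone_tuples_le (fun T => C (T ∘ σ.symm)) hψ hρ fun T hT j => ?_
        have h2 : (T ∘ σ.symm) ∘ σ = T := by
          funext i
          simp
        have h := hC (T ∘ σ.symm) σ (by rwa [h2]) j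
        rwa [h2] at h
    _ = _ := by
        rw [Finset.sum_const, Finset.card_univ, Fintype.card_perm, Fintype.card_fin, nsmul_eq_mul]

/-- A bound on the cumulants of a sum from bounds on mixed moments and on covariances of products
over separated index blocks. -/
lemma abs_cumulantSeq_sum_le {R : Type*} [CommRing R] [Algebra ℝ R] (E : R →ₗ[ℝ] ℝ)
    (hE : E 1 = 1) {n : ℕ} (X : Fin n → R) {w : ℕ → ℝ} {Ψ : ℕ → ℕ → ℝ} {D : ℝ} {ρ : ℕ → ℝ}
    (hD : 0 ≤ D) (hρ : ∀ r, 0 ≤ ρ r)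
    (hw : ∀ a b, w a * w b ≤ w (a + b)) (hw0 : ∀ a, 0 ≤ w a)
    (hΨ0 : ∀ u v, 0 ≤ Ψ u v) (hΨ : ∀ u v u' v', Ψ u v + Ψ u' v' ≤ Ψ (u + u') (v + v'))
    (m : ℕ)
    (hmom : ∀ (t : Fin (m + 2) → Fin n) (B : Finset (Fin (m + 2))),
      |E (∏ i ∈ B, X (t i))| ≤ w B.card)
    (hcov : ∀ (t : Fin (m + 2) → Fin n) (B₁ B₂ : Finset (Fin (m + 2))), B₁.Nonempty →
      B₂.Nonempty → ∀ p q : Fin n, p ≤ q → (∀ i ∈ B₁, t i ≤ p) → (∀ i ∈ B₂, q ≤ t i) →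
      |E ((∏ i ∈ B₁, X (t i)) * ∏ i ∈ B₂, X (t i))
          - E (∏ i ∈ B₁, X (t i)) * E (∏ i ∈ B₂, X (t i))|
        ≤ D * ρ (q.val - p.val) * Ψ B₁.card B₂.card * w (B₁.card + B₂.card)) :
    |cumulantSeq (fun j => E ((∑ i, X i) ^ j)) (m + 1)|
      ≤ (Nat.factorial (m + 2) : ℝ) * (n *
        (∑ j : Fin (m + 1), cumulantConst (m + 1) *
          (D * Ψ (j.val + 1) (m + 1 - j.val) * w (m + 2)))
        * ∑ s ∈ Finset.range n, ((s : ℝ) + 1) ^ m * ρ s) := by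
  rw [cumulantSeq_sum]
  refine (Finset.abs_sum_le_sum_abs _ _).trans ?_
  refine sum_tuples_le (fun t => abs_nonneg _) (fun j => ?_) hρ fun t σ hσ j => ?_
  · exact mul_nonneg (cumulantConst_nonneg _)
      (mul_nonneg (mul_nonneg hD (hΨ0 _ _)) (hw0 _))
  set U : Finset (Fin (m + 2)) := (Finset.Iic j.castSucc).map σ.toEmbedding with hU
  have hUcard : U.card = j.val + 1 := by simp [hU]
  have hsplit : ∀ B₁ B₂ : Finset (Fin (m + 2)), B₁ ⊆ U → Disjoint B₂ U →
      |E (∏ i ∈ B₁ ∪ B₂, X (t i)) - E (∏ i ∈ B₁, X (t i)) * E (∏ i ∈ B₂, X (t i))|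
        ≤ D * ρ (tupleGap (t ∘ σ) j) * Ψ B₁.card B₂.card * w (B₁.card + B₂.card) := by
    intro B₁ B₂ h₁ h₂
    have hnn : 0 ≤ D * ρ (tupleGap (t ∘ σ) j) * Ψ B₁.card B₂.card * w (B₁.card + B₂.card) :=
      mul_nonneg (mul_nonneg (mul_nonneg hD (hρ _)) (hΨ0 _ _)) (hw0 _)
    rw [Finset.prod_union (Finset.disjoint_of_subset_left h₁ h₂.symm)]
    rcases B₁.eq_empty_or_nonempty with rfl | hB₁
    · simpa [hE] using hnn
    rcases B₂.eq_empty_or_nonempty with rfl | hB₂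
    · simpa [hE] using hnn
    refine hcov t B₁ B₂ hB₁ hB₂ (t (σ j.castSucc)) (t (σ j.succ))
      (hσ (Fin.castSucc_lt_succ).le) (fun i hi => ?_) (fun i hi => ?_)
    · obtain ⟨a, ha, rfl⟩ := Finset.mem_map.1 (h₁ hi)
      exact hσ (Finset.mem_Iic.1 ha)
    · have hi' : ¬ σ.symm i ≤ j.castSucc := fun h =>
        Finset.disjoint_left.1 h₂ hi (Finset.mem_map.2 ⟨σ.symm i, Finset.mem_Iic.2 h, by simp⟩)
      have h := hσ (Fin.castSucc_lt_iff_succ_le.1 (not_le.1 hi'))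
      simpa using h
  have h := abs_subsetCumulant_le_of_split (k := m + 1)
    (f := fun B => E (∏ i ∈ B, X (t i))) (mul_nonneg hD (hρ (tupleGap (t ∘ σ) j))) hw hw0 hΨ0 hΨ
    (by simpa using hE) (hmom t) hsplit
    (by rw [← Finset.card_pos, hUcard]; omega)
    (fun h => by
      have := congrArg Finset.card h
      rw [hUcard, Finset.card_fin] at this
      omega)
  rw [hUcard] at h
  refine le_trans (le_of_eq ?_) (h.trans (le_of_eq ?_))
  · unfold jointCumulant
    congr 2
    · funext J
      rw [Finset.prod_insert, Finset.prod_map]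
      · rfl
      · intro h
        obtain ⟨i, _, hi⟩ := Finset.mem_map.1 h
        exact Fin.succ_ne_zero i hi
    · funext J
      rw [Finset.prod_map]
      rfl
  · rw [show m + 1 + 1 - (j.val + 1) = m + 1 - j.val by omega]
    ring

section MomentAlgebra

variable {Ω : Type*} [MeasurableSpace Ω]

/-- The algebra of random variables with finite moments of all orders. -/
def momentAlgebra (P : Measure Ω) [IsFiniteMeasure P] : Subalgebra ℝ (Ω → ℝ) where
  carrier := {f | AEStronglyMeasurable f P ∧ ∀ k : ℕ, Integrable (fun ω => |f ω| ^ k) P}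
  mul_mem' := by
    rintro f g ⟨hf, hf'⟩ ⟨hg, hg'⟩
    refine ⟨hf.mul hg, fun k => ?_⟩
    refine ((hf' (2 * k)).add (hg' (2 * k))).mono' ?_ (Filter.Eventually.of_forall fun ω => ?_)
    · exact (hf.mul hg).norm.pow k
    · simp only [Pi.mul_apply, Pi.add_apply, abs_mul, mul_pow, norm_mul, norm_pow, Real.norm_eq_abs,
        abs_abs, pow_mul']
      nlinarith [sq_nonneg (|f ω| ^ k - |g ω| ^ k), sq_nonneg (|f ω| ^ k), sq_nonneg (|g ω| ^ k)]
  add_mem' := by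
    rintro f g ⟨hf, hf'⟩ ⟨hg, hg'⟩
    refine ⟨hf.add hg, fun k => ?_⟩
    refine (((hf' k).add (hg' k)).const_mul (2 ^ (k - 1))).mono' ?_
      (Filter.Eventually.of_forall fun ω => ?_)
    · exact (hf.add hg).norm.pow k
    · simp only [Pi.add_apply, norm_pow, Real.norm_eq_abs, abs_abs]
      exact (pow_le_pow_left₀ (abs_nonneg _) (abs_add_le _ _) k).trans
        (add_pow_le (abs_nonneg _) (abs_nonneg _) k)
  algebraMap_mem' r := by
    refine ⟨aestronglyMeasurable_const, fun k => ?_⟩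
    exact integrable_const (|r| ^ k)

variable (P : Measure Ω) [IsFiniteMeasure P]

lemma momentAlgebra.integrable (f : momentAlgebra P) : Integrable f.1 P :=
  (f.2.2 1).mono' f.2.1 (Filter.Eventually.of_forall fun ω => by simp)

/-- The expectation on the algebra of random variables with finite moments of all orders. -/
noncomputable def momentAlgebra.expect : momentAlgebra P →ₗ[ℝ] ℝ where
  toFun f := ∫ ω, f.1 ω ∂P
  map_add' f g := integral_add (momentAlgebra.integrable P f) (momentAlgebra.integrable P g)
  map_smul' c f := integral_const_mul c f.1

end MomentAlgebra

/-- A mixed moment is bounded by a common bound for the absolute moments. -/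
lemma abs_integral_prod_le {Ω ι : Type*} [MeasurableSpace Ω] {P : Measure Ω} {B : Finset ι}
    (hB : B.Nonempty) {Y : ι → Ω → ℝ} {c : ℝ}
    (hinteg : ∀ i ∈ B, Integrable (fun ω => |Y i ω| ^ B.card) P)
    (hc : ∀ i ∈ B, ∫ ω, |Y i ω| ^ B.card ∂P ≤ c) :
    |∫ ω, ∏ i ∈ B, Y i ω ∂P| ≤ c := by
  have hb : 0 < (B.card : ℝ) := by exact_mod_cast hB.card_pos
  have hamgm : ∀ ω, |∏ i ∈ B, Y i ω| ≤ ∑ i ∈ B, (B.card : ℝ)⁻¹ * |Y i ω| ^ B.card := by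
    intro ω
    have h := Real.geom_mean_le_arith_mean_weighted B (fun _ => (B.card : ℝ)⁻¹)
      (fun i => |Y i ω| ^ B.card) (fun _ _ => by positivity)
      (by rw [Finset.sum_const, nsmul_eq_mul, mul_inv_cancel₀ hb.ne'])
      (fun _ _ => by positivity)
    refine le_trans (le_of_eq ?_) h
    rw [Finset.abs_prod]
    exact Finset.prod_congr rfl fun i _ =>
      (Real.pow_rpow_inv_natCast (abs_nonneg _) hB.card_pos.ne').symm
  have hi : ∀ i ∈ B, Integrable (fun ω => (B.card : ℝ)⁻¹ * |Y i ω| ^ B.card) P := fun i hi =>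
    (hinteg i hi).const_mul _
  calc |∫ ω, ∏ i ∈ B, Y i ω ∂P|
      ≤ ∫ ω, ∑ i ∈ B, (B.card : ℝ)⁻¹ * |Y i ω| ^ B.card ∂P :=
        norm_integral_le_of_norm_le (f := fun ω => ∏ i ∈ B, Y i ω) (integrable_finsetSum B hi)
          (Filter.Eventually.of_forall hamgm)
    _ = ∑ i ∈ B, (B.card : ℝ)⁻¹ * ∫ ω, |Y i ω| ^ B.card ∂P := by
        rw [integral_finsetSum B hi]
        simp only [integral_const_mul]
    _ ≤ ∑ _i ∈ B, (B.card : ℝ)⁻¹ * c :=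
        Finset.sum_le_sum fun i h => mul_le_mul_of_nonneg_left (hc i h) (by positivity)
    _ = c := by
        rw [Finset.sum_const, nsmul_eq_mul, mul_inv_cancel_left₀ hb.ne']

/-- The values of a function on a finset, enumerated in increasing order. -/
lemma exists_monotone_enum {ι β : Type*} [LinearOrder β] (B : Finset ι) (t : ι → β) :
    ∃ s : Fin B.card → β, Monotone s ∧ (∀ i, ∃ b ∈ B, s i = t b) ∧
      ∀ g : β → ℝ, ∏ i, g (s i) = ∏ b ∈ B, g (t b) := by
  set s₀ : Fin B.card → β := fun i => t (B.equivFin.symm i) with hs₀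
  refine ⟨s₀ ∘ Tuple.sort s₀, Tuple.monotone_sort s₀, fun i => ?_, fun g => ?_⟩
  · exact ⟨_, (B.equivFin.symm (Tuple.sort s₀ i)).2, rfl⟩
  · simp only [Function.comp_apply]
    rw [Equiv.prod_comp (Tuple.sort s₀) (fun i => g (s₀ i)),
      Equiv.prod_comp B.equivFin.symm (fun b : B => g (t b)),
      Finset.prod_coe_sort B (fun b => g (t b))]

lemma factorial_rpow_mul_pow_mul_le {ν M : ℝ} (hν : 0 ≤ ν) (hM : 0 ≤ M) (a b : ℕ) :
    ((Nat.factorial a : ℝ) ^ ν * M ^ a) * ((Nat.factorial b : ℝ) ^ ν * M ^ b)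
      ≤ (Nat.factorial (a + b) : ℝ) ^ ν * M ^ (a + b) := by
  have h : (Nat.factorial a : ℝ) * Nat.factorial b ≤ Nat.factorial (a + b) := by
    exact_mod_cast Nat.le_of_dvd (Nat.factorial_pos _)
      (Nat.factorial_mul_factorial_dvd_factorial_add a b)
  calc _ = ((Nat.factorial a : ℝ) * Nat.factorial b) ^ ν * M ^ (a + b) := by
        rw [Real.mul_rpow (by positivity) (by positivity), pow_add]
        ring
    _ ≤ _ := by gcongr

/-- The four admissible forms of the function that weights the sizes of the two blocks. -/
def IsDependenceWeight (Ψ : ℕ → ℕ → ℝ) : Prop :=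
  (∀ u v, Ψ u v = 2 * v) ∨ (∀ u v, Ψ u v = u + v) ∨ (∀ u v, Ψ u v = u * v) ∨
    (∃ α : ℝ, α ∈ Set.Ioo (0 : ℝ) 1 ∧ ∀ u v, Ψ u v = α * (u + v) + (1 - α) * (u * v))

lemma IsDependenceWeight.nonneg {Ψ : ℕ → ℕ → ℝ} (hΨ : IsDependenceWeight Ψ) (u v : ℕ) :
    0 ≤ Ψ u v := by
  rcases hΨ with h | h | h | ⟨α, ⟨h0, h1⟩, h⟩ <;> rw [h]
  · positivity
  · positivity
  · positivity
  · have : 0 ≤ 1 - α := by linarith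
    positivity

lemma IsDependenceWeight.add_le {Ψ : ℕ → ℕ → ℝ} (hΨ : IsDependenceWeight Ψ) (u v u' v' : ℕ) :
    Ψ u v + Ψ u' v' ≤ Ψ (u + u') (v + v') := by
  have hmul : (u : ℝ) * v + u' * v' ≤ (u + u') * (v + v') := by
    have h1 : (0 : ℝ) ≤ u * v' := by positivity
    have h2 : (0 : ℝ) ≤ u' * v := by positivity
    linarith
  rcases hΨ with h | h | h | ⟨α, ⟨h0, h1⟩, h⟩ <;> simp only [h, Nat.cast_add]
  · linarith
  · linarith
  · exact hmul
  · have h3 := mul_le_mul_of_nonneg_left hmul (sub_nonneg.2 h1.le)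
    linarith

lemma succ_le_pow_eleven_eighths {m : ℕ} (hm : 1 ≤ m) : (m : ℝ) + 1 ≤ (11 / 8) ^ (m + 2) := by
  rcases hm.eq_or_lt with rfl | h
  · norm_num
  clear hm
  replace h : 2 ≤ m := h
  induction m, h using Nat.le_induction with
  | base => norm_num
  | succ m hm ih =>
    rw [show m + 1 + 2 = (m + 2) + 1 by ring, pow_succ]
    have hm' : (2 : ℝ) ≤ m := by exact_mod_cast hm
    push_cast
    linarith

lemma mul_succ_le_pow_eleven_eighths (m : ℕ) :
    ((m : ℝ) + 1) * (m + 3) / 6 ≤ (11 / 8) ^ (m + 2) := by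
  by_cases hm : m < 4
  · interval_cases m <;> norm_num
  replace hm := not_lt.1 hm
  induction m, hm using Nat.le_induction with
  | base => norm_num
  | succ m hm ih =>
    rw [show m + 1 + 2 = (m + 2) + 1 by ring, pow_succ]
    have hm' : (4 : ℝ) ≤ m := by exact_mod_cast hm
    push_cast
    nlinarith

lemma sum_range_succ_mul_sub (a : ℝ) (N : ℕ) :
    ∑ j ∈ Finset.range N, ((j : ℝ) + 1) * (a - j)
      = a * N * (N + 1) / 2 - (N - 1) * N * (N + 1) / 3 := by
  induction N with
  | zero => simp
  | succ N ih =>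
    rw [Finset.sum_range_succ, ih]
    push_cast
    ring

lemma sum_range_two_mul_sub (a : ℝ) (N : ℕ) :
    ∑ j ∈ Finset.range N, 2 * (a - j) = 2 * a * N - N * (N - 1) := by
  induction N with
  | zero => simp
  | succ N ih =>
    rw [Finset.sum_range_succ, ih]
    push_cast
    ring

lemma IsDependenceWeight.sum_le {Ψ : ℕ → ℕ → ℝ} (hΨ : IsDependenceWeight Ψ) {m : ℕ} (hm : 1 ≤ m) :
    ∑ j : Fin (m + 1), Ψ (j.val + 1) (m + 1 - j.val) ≤ (m + 2) * (11 / 8) ^ (m + 2) := by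
  have hcast : ∀ j ∈ Finset.range (m + 1), ((m + 1 - j : ℕ) : ℝ) = m + 1 - j := by
    intro j hj
    rw [Nat.cast_sub (Finset.mem_range.1 hj).le]
    push_cast
    ring
  have hm2 : (0 : ℝ) ≤ m + 2 := by positivity
  have e1 := mul_le_mul_of_nonneg_left (succ_le_pow_eleven_eighths hm) hm2
  have e2 := mul_le_mul_of_nonneg_left (mul_succ_le_pow_eleven_eighths m) hm2
  have hsum : ∑ j ∈ Finset.range (m + 1), (((j + 1 : ℕ) : ℝ) + (m + 1 - j : ℕ))
      ≤ (m + 2) * (11 / 8) ^ (m + 2) := by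
    rw [Finset.sum_congr rfl (g := fun _ => (m : ℝ) + 2), Finset.sum_const, Finset.card_range,
      nsmul_eq_mul]
    · push_cast
      linarith
    · intro j hj
      rw [hcast j hj]
      push_cast
      ring
  have hprod : ∑ j ∈ Finset.range (m + 1), (((j + 1 : ℕ) : ℝ) * (m + 1 - j : ℕ))
      ≤ (m + 2) * (11 / 8) ^ (m + 2) := by
    rw [Finset.sum_congr rfl (g := fun j : ℕ => ((j : ℝ) + 1) * ((m + 1 : ℝ) - j)),
      sum_range_succ_mul_sub]
    · refine le_trans (le_of_eq ?_) e2
      push_cast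
      ring
    · intro j hj
      rw [hcast j hj]
      push_cast
      ring
  rw [Fin.sum_univ_eq_sum_range (fun j => Ψ (j + 1) (m + 1 - j)) (m + 1)]
  rcases hΨ with h | h | h | ⟨α, ⟨h0, h1⟩, h⟩ <;> simp only [h]
  · rw [Finset.sum_congr rfl (g := fun j : ℕ => 2 * ((m + 1 : ℝ) - j)), sum_range_two_mul_sub]
    · refine le_trans (le_of_eq ?_) e1
      push_cast
      ring
    · intro j hj
      rw [hcast j hj]
  · exact hsum
  · exact hprod
  · rw [Finset.sum_add_distrib, ← Finset.mul_sum, ← Finset.mul_sum]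
    have h2 := mul_le_mul_of_nonneg_left hsum h0.le
    have h3 := mul_le_mul_of_nonneg_left hprod (sub_nonneg.2 h1.le)
    linarith

lemma cumulantConst_mul_sum_le {Ψ : ℕ → ℕ → ℝ} (hΨ : IsDependenceWeight Ψ) {m : ℕ} (hm : 1 ≤ m) :
    cumulantConst (m + 1) * ∑ j : Fin (m + 1), Ψ (j.val + 1) (m + 1 - j.val)
      ≤ (Nat.factorial (m + 2) : ℝ) * 2 ^ (m + 2) := by
  refine (mul_le_mul (cumulantConst_le (m + 1)) (hΨ.sum_le hm)
    (Finset.sum_nonneg fun _ _ => hΨ.nonneg _ _) (by positivity)).trans (le_of_eq ?_)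
  rw [show (2 : ℝ) = (16 / 11) * (11 / 8) by norm_num, mul_pow, Nat.factorial_succ (m + 1)]
  push_cast
  ring

/-- The covariance hypothesis for ordered tuples, transferred to products over two separated
blocks of indices. -/
lemma abs_cov_prod_le {Ω ι : Type*} [MeasurableSpace Ω] {P : Measure Ω}
    {n : ℕ} {X : ℕ → Ω → ℝ} {Ψ : ℕ → ℕ → ℝ} {K M ν : ℝ} (hM : 0 ≤ M)
    {ρ : ℕ → ℝ} (hρmono : Antitone ρ) (hΨ0 : ∀ u v, 0 ≤ Ψ u v)
    (hcov : ∀ (u v : ℕ) (hu : 0 < u) (hv : 0 < v)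
        (s : Fin u → ℕ) (t : Fin v → ℕ), Monotone s → Monotone t →
        1 ≤ s ⟨0, hu⟩ → s ⟨u - 1, Nat.sub_lt hu Nat.one_pos⟩ ≤ t ⟨0, hv⟩ →
        t ⟨v - 1, Nat.sub_lt hv Nat.one_pos⟩ ≤ n →
        |(∫ ω, (∏ i, X (s i) ω) * (∏ j, X (t j) ω) ∂P)
            - (∫ ω, ∏ i, X (s i) ω ∂P) * (∫ ω, ∏ j, X (t j) ω ∂P)|
          ≤ K ^ 2 * M ^ (u + v - 2) * ((Nat.factorial (u + v) : ℝ)) ^ ν * Ψ u v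
              * ρ (t ⟨0, hv⟩ - s ⟨u - 1, Nat.sub_lt hu Nat.one_pos⟩))
    (t : ι → Fin n) {B₁ B₂ : Finset ι} (h₁ : B₁.Nonempty) (h₂ : B₂.Nonempty) {p q : Fin n}
    (hpq : p ≤ q) (hp : ∀ i ∈ B₁, t i ≤ p) (hq : ∀ i ∈ B₂, q ≤ t i) :
    |(∫ ω, (∏ i ∈ B₁, X (t i + 1) ω) * (∏ i ∈ B₂, X (t i + 1) ω) ∂P)
        - (∫ ω, ∏ i ∈ B₁, X (t i + 1) ω ∂P) * (∫ ω, ∏ i ∈ B₂, X (t i + 1) ω ∂P)|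
      ≤ K ^ 2 * M ^ (B₁.card + B₂.card - 2) * ((Nat.factorial (B₁.card + B₂.card) : ℝ)) ^ ν
          * Ψ B₁.card B₂.card * ρ (q.val - p.val) := by
  obtain ⟨s₁, hs₁, hm₁, hg₁⟩ := exists_monotone_enum B₁ (fun i => (t i).val + 1)
  obtain ⟨s₂, hs₂, hm₂, hg₂⟩ := exists_monotone_enum B₂ (fun i => (t i).val + 1)
  have hle₁ : ∀ i, 1 ≤ s₁ i ∧ s₁ i ≤ p.val + 1 := by
    intro i
    obtain ⟨b, hb, h⟩ := hm₁ i
    have : (t b).val ≤ p.val := hp b hb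
    omega
  have hle₂ : ∀ i, q.val + 1 ≤ s₂ i ∧ s₂ i ≤ n := by
    intro i
    obtain ⟨b, hb, h⟩ := hm₂ i
    have : q.val ≤ (t b).val := hq b hb
    have := (t b).isLt
    omega
  have hpq' : p.val ≤ q.val := hpq
  have h := hcov B₁.card B₂.card h₁.card_pos h₂.card_pos s₁ s₂ hs₁ hs₂ (hle₁ _).1
    (by
      have e1 := (hle₁ ⟨B₁.card - 1, Nat.sub_lt h₁.card_pos Nat.one_pos⟩).2
      have e2 := (hle₂ ⟨0, h₂.card_pos⟩).1
      omega) (hle₂ _).2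
  have e₁ : ∀ ω, ∏ i, X (s₁ i) ω = ∏ i ∈ B₁, X (t i + 1) ω := fun ω => hg₁ fun j => X j ω
  have e₂ : ∀ ω, ∏ i, X (s₂ i) ω = ∏ i ∈ B₂, X (t i + 1) ω := fun ω => hg₂ fun j => X j ω
  simp only [e₁, e₂] at h
  refine h.trans (mul_le_mul_of_nonneg_left (hρmono ?_) ?_)
  · have e1 := (hle₁ ⟨B₁.card - 1, Nat.sub_lt h₁.card_pos Nat.one_pos⟩).2
    have e2 := (hle₂ ⟨0, h₂.card_pos⟩).1
    omega
  · have := hΨ0 B₁.card B₂.card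
    positivity

/-- Comparison of the combinatorial cumulant bound with its final form. -/
lemma cumulant_bound_arith {n : ℕ} {K M L₁ L₂ μ ν A c Q F : ℝ} (hM : 0 ≤ M) (hL₁ : 0 ≤ L₁)
    (hL₂ : 0 ≤ L₂) (hμ : 0 ≤ μ) (hA : 0 < A) {m : ℕ} (hm : 1 ≤ m)
    (hF : F = Nat.factorial (m + 2)) (hc : c ≤ F * 2 ^ (m + 2))
    (hQ : Q ≤ L₁ * L₂ ^ m * (Nat.factorial m : ℝ) ^ μ) (hQ0 : 0 ≤ Q) :
    F * (n * (K ^ 2 * M ^ m * F ^ ν * c) * Q)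
      ≤ (F / 2) ^ (1 + (μ + ν + 1)) * A *
        (2 * M * L₂ * (((2 : ℝ) ^ (4 + μ + ν) * n * K ^ 2 * L₁ / A) ⊔ 1)) ^ m := by
  have hF0 : 0 < F := by
    rw [hF]
    positivity
  have hfac : (Nat.factorial m : ℝ) ^ μ ≤ F ^ μ := by
    rw [hF]
    exact Real.rpow_le_rpow (by positivity)
      (by exact_mod_cast Nat.factorial_le (by omega)) hμ
  set H : ℝ := (2 : ℝ) ^ (4 + μ + ν) * n * K ^ 2 * L₁ / A with hH
  have hHm : H ≤ (H ⊔ 1) ^ m :=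
    (le_max_left _ _).trans (le_self_pow₀ (le_max_right _ _) (by omega))
  have hsplit : (F / 2) ^ (1 + (μ + ν + 1)) * 2 ^ (4 + μ + ν) = F ^ 2 * F ^ μ * F ^ ν * 4 := by
    have h2 : (2 : ℝ) ^ (4 + μ + ν) = 2 ^ (1 + (μ + ν + 1)) * 4 := by
      rw [show 4 + μ + ν = (1 + (μ + ν + 1)) + 2 by ring, Real.rpow_add two_pos, Real.rpow_two]
      norm_num
    have h3 : F ^ (1 + (μ + ν + 1)) = F ^ 2 * F ^ μ * F ^ ν := by
      rw [show 1 + (μ + ν + 1) = 2 + μ + ν by ring, Real.rpow_add hF0, Real.rpow_add hF0,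
        Real.rpow_two]
    have h4 : (2 : ℝ) ^ (1 + (μ + ν + 1)) ≠ 0 := (Real.rpow_pos_of_pos two_pos _).ne'
    rw [Real.div_rpow hF0.le two_pos.le, h2, h3]
    field_simp
  calc F * (n * (K ^ 2 * M ^ m * F ^ ν * c) * Q)
      ≤ F * (n * (K ^ 2 * M ^ m * F ^ ν * (F * 2 ^ (m + 2))) * (L₁ * L₂ ^ m * F ^ μ)) := by
        gcongr
        exact hQ.trans (mul_le_mul_of_nonneg_left hfac (by positivity))
    _ = (F ^ 2 * F ^ μ * F ^ ν * 4) * (n * K ^ 2 * L₁) * (2 * M * L₂) ^ m := by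
        rw [mul_pow, mul_pow]
        ring
    _ = (F / 2) ^ (1 + (μ + ν + 1)) * A * ((2 * M * L₂) ^ m * H) := by
        rw [← hsplit, hH]
        field_simp
    _ ≤ (F / 2) ^ (1 + (μ + ν + 1)) * A * ((2 * M * L₂) ^ m * (H ⊔ 1) ^ m) := by
        gcongr
    _ = _ := by rw [← mul_pow]

/-- The tail inequality when the moment and decay constants are positive. -/
lemma bernstein_of_pos {Ω : Type*} [MeasurableSpace Ω] (P : Measure Ω) [IsProbabilityMeasure P]
    {n : ℕ} {X : ℕ → Ω → ℝ} (hmeas : ∀ i, Measurable (X i))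
    (hmean : ∀ i ∈ Finset.Icc 1 n, ∫ ω, X i ω ∂P = 0)
    {Ψ : ℕ → ℕ → ℝ} (hΨ : IsDependenceWeight Ψ)
    {K M L₁ L₂ μ ν : ℝ} (hM : 0 < M) (hL₁ : 0 ≤ L₁) (hL₂ : 0 < L₂) (hμ : 0 ≤ μ) (hν : 0 ≤ ν)
    {ρ : ℕ → ℝ} (hρ0 : ∀ r, 0 ≤ ρ r) (hρmono : Antitone ρ)
    (hcov : ∀ (u v : ℕ) (hu : 0 < u) (hv : 0 < v)
        (s : Fin u → ℕ) (t : Fin v → ℕ), Monotone s → Monotone t →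
        1 ≤ s ⟨0, hu⟩ → s ⟨u - 1, Nat.sub_lt hu Nat.one_pos⟩ ≤ t ⟨0, hv⟩ →
        t ⟨v - 1, Nat.sub_lt hv Nat.one_pos⟩ ≤ n →
        |(∫ ω, (∏ i, X (s i) ω) * (∏ j, X (t j) ω) ∂P)
            - (∫ ω, ∏ i, X (s i) ω ∂P) * (∫ ω, ∏ j, X (t j) ω ∂P)|
          ≤ K ^ 2 * M ^ (u + v - 2) * ((Nat.factorial (u + v) : ℝ)) ^ ν * Ψ u v
              * ρ (t ⟨0, hv⟩ - s ⟨u - 1, Nat.sub_lt hu Nat.one_pos⟩))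
    (hρsum : ∀ k : ℕ, ∑' s : ℕ, ENNReal.ofReal (((s : ℝ) + 1) ^ k * ρ s)
        ≤ ENNReal.ofReal (L₁ * L₂ ^ k * ((Nat.factorial k : ℝ)) ^ μ))
    (hmom : ∀ i ∈ Finset.Icc 1 n, ∀ k : ℕ,
        ∫⁻ ω, ENNReal.ofReal (|X i ω| ^ k) ∂P
          ≤ ENNReal.ofReal (((Nat.factorial k : ℝ)) ^ ν * M ^ k))
    {A : ℝ} (hA0 : 0 < A)
    (hAvar : variance (fun ω => ∑ i ∈ Finset.Icc 1 n, X i ω) P ≤ A) {x : ℝ} (hx : 0 < x) :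
    P.real {ω | x ≤ ∑ i ∈ Finset.Icc 1 n, X i ω}
      ≤ Real.exp (-(x ^ 2 / 2) /
          (A + (2 * M * L₂ * (((2 : ℝ) ^ (4 + μ + ν) * n * K ^ 2 * L₁ / A) ⊔ 1))
                ^ ((1 : ℝ) / (μ + ν + 2))
              * x ^ ((2 * μ + 2 * ν + 3) / (μ + ν + 2)))) := by
  have hinteg : ∀ i ∈ Finset.Icc 1 n, ∀ k : ℕ, Integrable (fun ω => |X i ω| ^ k) P := by
    intro i hi k
    refine ⟨((hmeas i).abs.pow_const k).aestronglyMeasurable, ?_⟩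
    rw [hasFiniteIntegral_iff_ofReal (Filter.Eventually.of_forall fun ω => by positivity)]
    exact (hmom i hi k).trans_lt ENNReal.ofReal_lt_top
  have hmom' : ∀ i ∈ Finset.Icc 1 n, ∀ k : ℕ,
      ∫ ω, |X i ω| ^ k ∂P ≤ (Nat.factorial k : ℝ) ^ ν * M ^ k := by
    intro i hi k
    rw [integral_eq_lintegral_of_nonneg_ae (Filter.Eventually.of_forall fun ω => by positivity)
      ((hmeas i).abs.pow_const k).aestronglyMeasurable]
    exact ENNReal.toReal_le_of_le_ofReal (by positivity) (hmom i hi k)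
  have hmem : ∀ i : Fin n, i.val + 1 ∈ Finset.Icc 1 n := fun i => by
    have := i.isLt
    rw [Finset.mem_Icc]
    omega
  set Y : Fin n → momentAlgebra P := fun i =>
    ⟨X (i.val + 1), (hmeas _).aestronglyMeasurable, hinteg _ (hmem i)⟩ with hY
  set E := momentAlgebra.expect P with hEdef
  have hE : ∀ f : momentAlgebra P, E f = ∫ ω, f.1 ω ∂P := fun f => rfl
  have hprod : ∀ {ι : Type} (B : Finset ι) (t : ι → Fin n) (ω : Ω),
      (∏ i ∈ B, Y (t i)).1 ω = ∏ i ∈ B, X ((t i).val + 1) ω := by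
    intro ι B t ω
    have : (∏ i ∈ B, Y (t i)).1 = ∏ i ∈ B, X ((t i).val + 1) :=
      map_prod (momentAlgebra P).val _ _
    rw [this, Finset.prod_apply]
  have hS : ∀ (k : ℕ) (ω : Ω), ((∑ i, Y i) ^ k).1 ω = (∑ i ∈ Finset.Icc 1 n, X i ω) ^ k := by
    intro k ω
    have h1 : (∑ i, Y i).1 = ∑ i : Fin n, X (i.val + 1) := map_sum (momentAlgebra P).val _ _
    have h2 : ((∑ i, Y i) ^ k).1 = ((∑ i, Y i).1) ^ k := map_pow (momentAlgebra P).val _ _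
    rw [h2, h1, Pi.pow_apply, Finset.sum_apply, Fin.sum_univ_eq_sum_range (fun i => X (i + 1) ω),
      Finset.range_eq_Ico, Finset.sum_Ico_add' (fun i => X i ω) 0 n 1]
    rfl
  have hφ : ∀ k : ℕ, E ((∑ i, Y i) ^ k) = ∫ ω, (∑ i ∈ Finset.Icc 1 n, X i ω) ^ k ∂P := by
    intro k
    rw [hE]
    simp only [hS]
  have hSint : ∀ k : ℕ, Integrable (fun ω => (∑ i ∈ Finset.Icc 1 n, X i ω) ^ k) P := by
    intro k
    have h := momentAlgebra.integrable P ((∑ i, Y i) ^ k)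
    rwa [funext (hS k)] at h
  set φ : ℕ → ℝ := fun k => ∫ ω, (∑ i ∈ Finset.Icc 1 n, X i ω) ^ k ∂P with hφdef
  have hφ' : (fun j => E ((∑ i, Y i) ^ j)) = φ := funext hφ
  have hφ0 : φ 0 = 1 := by simp [hφdef]
  have hφ1 : φ 1 = 0 := by
    simp only [hφdef, pow_one]
    rw [integral_finsetSum _ fun i hi => ?_]
    · exact Finset.sum_eq_zero hmean
    · exact momentAlgebra.integrable P ⟨X i, (hmeas i).aestronglyMeasurable, hinteg i hi⟩
  have hG0 : cumulantSeq φ 0 = 0 := by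
    rw [cumulantSeq_eq]
    simpa using hφ1
  have hγ : 1 ≤ μ + ν + 1 := by linarith
  set Bc : ℝ := 2 * M * L₂ * (((2 : ℝ) ^ (4 + μ + ν) * n * K ^ 2 * L₁ / A) ⊔ 1) with hBc
  have hBpos : 0 < Bc := mul_pos (by positivity) (lt_max_of_lt_right one_pos)
  have hw0 : ∀ a : ℕ, 0 ≤ (Nat.factorial a : ℝ) ^ ν * M ^ a := fun a => by positivity
  have hcum : ∀ j : ℕ, |cumulantSeq φ (j + 1)|
      ≤ ((Nat.factorial (j + 2) : ℝ) / 2) ^ (1 + (μ + ν + 1)) * A * Bc ^ j := by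
    intro j
    rcases Nat.eq_zero_or_pos j with rfl | hj
    · have h2 : cumulantSeq φ (0 + 1) = φ 2 := by
        rw [cumulantSeq_eq]
        simp [hG0]
      have hvar : variance (fun ω => ∑ i ∈ Finset.Icc 1 n, X i ω) P = φ 2 := by
        refine variance_of_integral_eq_zero ?_ ?_
        · exact (Finset.measurable_sum _ fun i _ => hmeas i).aemeasurable
        · simpa [hφdef] using hφ1
      rw [h2, ← hvar, abs_of_nonneg (variance_nonneg _ _)]
      simpa using hAvar
    · have hb := abs_cumulantSeq_sum_le E (by simp [hE]) Y
        (w := fun a => (Nat.factorial a : ℝ) ^ ν * M ^ a) (Ψ := Ψ) (D := K ^ 2 * (M ^ 2)⁻¹)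
        (ρ := ρ) (by positivity) hρ0 (factorial_rpow_mul_pow_mul_le hν hM.le) hw0 hΨ.nonneg
        hΨ.add_le j ?_ ?_
      · rw [hφ'] at hb
        refine hb.trans ?_
        have hQ : ∑ s ∈ Finset.range n, ((s : ℝ) + 1) ^ j * ρ s
            ≤ L₁ * L₂ ^ j * (Nat.factorial j : ℝ) ^ μ := by
          have hnn : ∀ s ∈ Finset.range n, 0 ≤ ((s : ℝ) + 1) ^ j * ρ s := fun s _ =>
            mul_nonneg (by positivity) (hρ0 s)
          rw [← ENNReal.ofReal_le_ofReal_iff (by positivity), ENNReal.ofReal_sum_of_nonneg hnn]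
          exact (ENNReal.sum_le_tsum _).trans (hρsum j)
        refine le_trans (le_of_eq ?_) (cumulant_bound_arith (K := K) (ν := ν) (n := n) hM.le hL₁
          hL₂.le hμ hA0 hj rfl (cumulantConst_mul_sum_le hΨ hj) hQ
          (Finset.sum_nonneg fun s _ => mul_nonneg (by positivity) (hρ0 s)))
        simp only [← Finset.mul_sum, ← Finset.sum_mul]
        rw [pow_add]
        field_simp
      · intro t B
        rw [hE]
        simp only [hprod]
        rcases B.eq_empty_or_nonempty with rfl | hB
        · simp
        · exact abs_integral_prod_le hB (fun i _ => hinteg _ (hmem (t i)) _)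
            (fun i _ => hmom' _ (hmem (t i)) _)
      · intro t B₁ B₂ h₁ h₂ p q hpq hp hq
        have h := abs_cov_prod_le hM.le hρmono hΨ.nonneg hcov t h₁ h₂ hpq hp hq
        have hmul : ∀ ω, ((∏ i ∈ B₁, Y (t i)) * ∏ i ∈ B₂, Y (t i)).1 ω
            = (∏ i ∈ B₁, X ((t i).val + 1) ω) * ∏ i ∈ B₂, X ((t i).val + 1) ω := by
          intro ω
          rw [← hprod, ← hprod]
          rfl
        simp only [hE, hmul, hprod]
        refine h.trans (le_of_eq ?_)
        have h2 : 2 ≤ B₁.card + B₂.card := by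
          have := h₁.card_pos
          have := h₂.card_pos
          omega
        rw [pow_sub₀ M hM.ne' h2]
        ring
  have hmain := tail_le_exp_of_cumulant_bound P hSint (cumulantSeq φ) (fun k => ?_) hG0 hγ hA0
    hBpos hcum hx
  · rwa [show 1 + (μ + ν + 1) = μ + ν + 2 by ring,
      show 1 + 2 * (μ + ν + 1) = 2 * μ + 2 * ν + 3 by ring] at hmain
  · change φ (k + 1) = ∑ j ∈ Finset.range (k + 1), (k.choose j : ℝ) * (cumulantSeq φ j * φ (k - j))
    rw [Finset.sum_range_succ, cumulantSeq_eq φ k, Nat.sub_self, hφ0, Nat.choose_self]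
    simp

/-- **Theorem 4.5 (Doukhan and Neumann, 2007).** A Bernstein-type exponential tail
inequality for sums of weakly dependent random variables, with the variance of the sum in
the asymptotically leading term of the exponent. -/
theorem bernstein_inequality_weak_dependence
    {Ω : Type*} [MeasurableSpace Ω] (P : Measure Ω) [IsProbabilityMeasure P]
    (n : ℕ) (X : ℕ → Ω → ℝ)
    (hmeas : ∀ i, Measurable (X i))
    (hmean : ∀ i ∈ Finset.Icc 1 n, ∫ ω, X i ω ∂P = 0)
    (Ψ : ℕ → ℕ → ℝ)
    (hΨ : (∀ u v, Ψ u v = 2 * v) ∨ (∀ u v, Ψ u v = u + v) ∨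
          (∀ u v, Ψ u v = u * v) ∨
          (∃ α : ℝ, α ∈ Set.Ioo (0 : ℝ) 1 ∧
            ∀ u v, Ψ u v = α * (u + v) + (1 - α) * (u * v)))
    (K M L₁ L₂ : ℝ) (hK : 0 ≤ K) (hM : 0 ≤ M) (hL₂ : 0 ≤ L₂)
    (μ ν : ℝ) (hμ : 0 ≤ μ) (hν : 0 ≤ ν)
    (ρ : ℕ → ℝ) (hρ0 : ∀ r, 0 ≤ ρ r) (hρmono : Antitone ρ)
    -- (4.12)
    (hcov : ∀ (u v : ℕ) (hu : 0 < u) (hv : 0 < v)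
        (s : Fin u → ℕ) (t : Fin v → ℕ), Monotone s → Monotone t →
        1 ≤ s ⟨0, hu⟩ → s ⟨u - 1, Nat.sub_lt hu Nat.one_pos⟩ ≤ t ⟨0, hv⟩ →
        t ⟨v - 1, Nat.sub_lt hv Nat.one_pos⟩ ≤ n →
        |(∫ ω, (∏ i, X (s i) ω) * (∏ j, X (t j) ω) ∂P)
            - (∫ ω, ∏ i, X (s i) ω ∂P) * (∫ ω, ∏ j, X (t j) ω ∂P)|
          ≤ K ^ 2 * M ^ (u + v - 2) * ((Nat.factorial (u + v) : ℝ)) ^ ν * Ψ u v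
              * ρ (t ⟨0, hv⟩ - s ⟨u - 1, Nat.sub_lt hu Nat.one_pos⟩))
    -- (4.13)
    (hρsum : ∀ k : ℕ, ∑' s : ℕ, ENNReal.ofReal (((s : ℝ) + 1) ^ k * ρ s)
        ≤ ENNReal.ofReal (L₁ * L₂ ^ k * ((Nat.factorial k : ℝ)) ^ μ))
    -- (4.14)
    (hmom : ∀ i ∈ Finset.Icc 1 n, ∀ k : ℕ,
        ∫⁻ ω, ENNReal.ofReal (|X i ω| ^ k) ∂P
          ≤ ENNReal.ofReal (((Nat.factorial k : ℝ)) ^ ν * M ^ k))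
    (A : ℝ) (hA0 : 0 < A)
    (hAvar : variance (fun ω => ∑ i ∈ Finset.Icc 1 n, X i ω) P ≤ A) :
    ∀ t : ℝ, 0 ≤ t →
      (P {ω | t ≤ ∑ i ∈ Finset.Icc 1 n, X i ω}).toReal
        ≤ Real.exp (-(t ^ 2 / 2) /
            (A + (2 * (K ⊔ M) * L₂
                    * (((2 : ℝ) ^ (4 + μ + ν) * n * K ^ 2 * L₁ / A) ⊔ 1))
                  ^ ((1 : ℝ) / (μ + ν + 2))
                * t ^ ((2 * μ + 2 * ν + 3) / (μ + ν + 2)))) := by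
  intro t ht
  change P.real _ ≤ _
  rcases ht.eq_or_lt with rfl | ht
  · refine measureReal_le_one.trans (le_of_eq ?_)
    simp
  have hW : IsDependenceWeight Ψ := hΨ
  have hmax : ((2 : ℝ) ^ (4 + μ + ν) * n * K ^ 2 * (L₁ ⊔ 0) / A) ⊔ 1
      = ((2 : ℝ) ^ (4 + μ + ν) * n * K ^ 2 * L₁ / A) ⊔ 1 := by
    rcases le_total 0 L₁ with h | h
    · rw [max_eq_left h]
    · have hneg : (2 : ℝ) ^ (4 + μ + ν) * n * K ^ 2 * L₁ / A ≤ 0 :=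
        div_nonpos_of_nonpos_of_nonneg (mul_nonpos_of_nonneg_of_nonpos (by positivity) h) hA0.le
      rw [max_eq_right h, max_eq_right (hneg.trans zero_le_one)]
      simp
  set H : ℝ := ((2 : ℝ) ^ (4 + μ + ν) * n * K ^ 2 * L₁ / A) ⊔ 1 with hH
  have hH0 : 0 ≤ H := zero_le_one.trans (le_max_right _ _)
  have hKM : 0 ≤ K ⊔ M := hK.trans (le_max_left _ _)
  set g : ℝ → ℝ := fun ε => Real.exp (-(t ^ 2 / 2) /
    (A + (2 * ((K ⊔ M) + ε) * (L₂ + ε) * H) ^ ((1 : ℝ) / (μ + ν + 2))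
      * t ^ ((2 * μ + 2 * ν + 3) / (μ + ν + 2)))) with hg
  have hbound : ∀ ε : ℝ, 0 < ε → P.real {ω | t ≤ ∑ i ∈ Finset.Icc 1 n, X i ω} ≤ g ε := by
    intro ε hε
    have hMε : M ≤ (K ⊔ M) + ε := (le_max_right K M).trans (by linarith)
    have hLε : L₂ ≤ L₂ + ε := by linarith
    have h := bernstein_of_pos P hmeas hmean hW (K := K) (M := (K ⊔ M) + ε) (L₁ := L₁ ⊔ 0)
      (L₂ := L₂ + ε) (by linarith) (le_max_right _ _) (by linarith) hμ hν hρ0 hρmono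
      (fun u v hu hv s t hs ht h1 h2 h3 => (hcov u v hu hv s t hs ht h1 h2 h3).trans ?_)
      (fun k => (hρsum k).trans (ENNReal.ofReal_le_ofReal ?_))
      (fun i hi k => (hmom i hi k).trans (ENNReal.ofReal_le_ofReal ?_)) hA0 hAvar ht
    · rwa [hmax] at h
    · have := hW.nonneg u v
      have := hρ0 (t ⟨0, hv⟩ - s ⟨u - 1, Nat.sub_lt hu Nat.one_pos⟩)
      gcongr
    · gcongr
      exact le_max_left _ _
    · gcongr
  have hcont : ContinuousAt g 0 := by
    have hbase : ContinuousAt (fun ε : ℝ => 2 * ((K ⊔ M) + ε) * (L₂ + ε) * H) 0 := by fun_prop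
    have hpow := hbase.rpow_const (p := (1 : ℝ) / (μ + ν + 2)) (Or.inr (by positivity))
    refine (ContinuousAt.div continuousAt_const
      (continuousAt_const.add (hpow.mul continuousAt_const)) ?_).rexp
    simp only [Pi.add_apply, Pi.mul_apply, add_zero]
    positivity
  have hlim : Filter.Tendsto g (nhdsWithin 0 (Set.Ioi 0)) (nhds (g 0)) :=
    hcont.tendsto.mono_left nhdsWithin_le_nhds
  have hfin := ge_of_tendsto hlim
    (Filter.eventually_of_mem self_mem_nhdsWithin fun ε hε => hbound ε hε)
  simpa only [hg, add_zero] using hfin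
end

section
/- Let (X_t)_{t∈ℤ} be a stationary sequence of real random variables with E|X_0|^m < ∞ for some m > 2. Suppose there are constants c ≥ 0 and a > 1 + 1/(m−2) such that for every r ≥ 1, every measurable g : ℝ → ℝ with sup|g| ≤ 1 and every Lipschitz h : ℝ → ℝ with sup|h| ≤ 1, |cov(g(X_0), h(X_r))| ≤ Lip(h) · c · r^{−a}, where Lip(h) is the Lipschitz constant of h. Then Σ_{t=1}^∞ |cov(X_0, X_t)| < ∞; in particular σ² = Σ_{t∈ℤ} cov(X_0, X_t) = E[X_0²] + 2 Σ_{t=1}^∞ cov(X_0, X_t) is well defined as an absolutely convergent series. -/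
open MeasureTheory ProbabilityTheory

/-- Truncation of a real number to the interval `[-M, M]`. -/
def truncAt (M x : ℝ) : ℝ := max (-M) (min x M)

lemma measurable_truncAt (M : ℝ) : Measurable (truncAt M) := by
  unfold truncAt
  fun_prop

lemma abs_truncAt_le {M : ℝ} (hM : 0 ≤ M) (x : ℝ) : |truncAt M x| ≤ M := by
  unfold truncAt
  grind

lemma abs_truncAt_le_abs {M : ℝ} (hM : 0 ≤ M) (x : ℝ) : |truncAt M x| ≤ |x| := by
  unfold truncAt
  grind

lemma truncAt_eq_self {M x : ℝ} (hx : |x| ≤ M) : truncAt M x = x := by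
  unfold truncAt
  grind

lemma abs_truncAt_sub_le (M x y : ℝ) : |truncAt M x - truncAt M y| ≤ |x - y| := by
  unfold truncAt
  calc |max (-M) (min x M) - max (-M) (min y M)|
      ≤ max |-M - -M| |min x M - min y M| := abs_max_sub_max_le_max _ _ _ _
    _ = |min x M - min y M| := by simp
    _ ≤ max |x - y| |M - M| := abs_min_sub_min_le_max _ _ _ _
    _ = |x - y| := by simp

lemma sq_le_rpow_mul_rpow {m M z : ℝ} (hm : 2 ≤ m) (hM : 0 < M) (hz : M ≤ z) :
    z ^ 2 ≤ M ^ (2 - m) * z ^ m := by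
  have hz0 : 0 < z := hM.trans_le hz
  calc z ^ 2 = z ^ (2 - m) * z ^ m := by
        rw [← Real.rpow_add hz0, ← Real.rpow_natCast]
        norm_num
    _ ≤ M ^ (2 - m) * z ^ m := by
        gcongr ?_ * _
        exact Real.rpow_le_rpow_of_nonpos hM hz (by linarith)

/-- The error made by truncating both factors of a product. -/
lemma abs_mul_sub_truncAt_mul_le {m M : ℝ} (hm : 2 ≤ m) (hM : 0 < M) (x y : ℝ) :
    |x * y - truncAt M x * truncAt M y| ≤ 2 * M ^ (2 - m) * (|x| ^ m + |y| ^ m) := by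
  have hp : 0 ≤ M ^ (2 - m) := by positivity
  have hxm : 0 ≤ |x| ^ m := by positivity
  have hym : 0 ≤ |y| ^ m := by positivity
  have hprod : |x * y - truncAt M x * truncAt M y| ≤ 2 * (|x| * |y|) := by
    calc _ ≤ |x * y| + |truncAt M x * truncAt M y| := abs_sub _ _
      _ = |x| * |y| + |truncAt M x| * |truncAt M y| := by rw [abs_mul, abs_mul]
      _ ≤ |x| * |y| + |x| * |y| := by
        gcongr |x| * |y| + ?_
        exact mul_le_mul (abs_truncAt_le_abs hM.le _) (abs_truncAt_le_abs hM.le _)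
          (abs_nonneg _) (abs_nonneg _)
      _ = _ := by ring
  have hx0 := abs_nonneg x
  have hy0 := abs_nonneg y
  by_cases hsmall : |x| ≤ M ∧ |y| ≤ M
  · rw [truncAt_eq_self hsmall.1, truncAt_eq_self hsmall.2, sub_self, abs_zero]
    positivity
  · rcases le_total |x| |y| with hxy | hxy
    · have := sq_le_rpow_mul_rpow hm hM (z := |y|) (by grind)
      nlinarith [mul_nonneg hp hxm]
    · have := sq_le_rpow_mul_rpow hm hM (z := |x|) (by grind)
      nlinarith [mul_nonneg hp hym]

lemma abs_integral_mul_sub_truncAt_le {α : Type*} [MeasurableSpace α] (μ : Measure α)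
    [IsFiniteMeasure μ] {U V : α → ℝ} (hU : Measurable U) (hV : Measurable V) {m M : ℝ}
    (hm : 2 ≤ m) (hM : 0 < M) (hUm : Integrable (fun ω => |U ω| ^ m) μ)
    (hVm : Integrable (fun ω => |V ω| ^ m) μ) :
    |(∫ ω, U ω * V ω ∂μ) - ∫ ω, truncAt M (U ω) * truncAt M (V ω) ∂μ|
      ≤ 2 * M ^ (2 - m) * ((∫ ω, |U ω| ^ m ∂μ) + ∫ ω, |V ω| ^ m ∂μ) := by
  have hTU := (measurable_truncAt M).comp hU
  have hTV := (measurable_truncAt M).comp hV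
  have hT : Integrable (fun ω => truncAt M (U ω) * truncAt M (V ω)) μ := by
    refine Integrable.of_bound (hTU.mul hTV).aestronglyMeasurable (M * M)
      (Filter.Eventually.of_forall fun ω => ?_)
    rw [Real.norm_eq_abs, abs_mul]
    exact mul_le_mul (abs_truncAt_le hM.le _) (abs_truncAt_le hM.le _) (abs_nonneg _) hM.le
  have hbound : Integrable (fun ω => 2 * M ^ (2 - m) * (|U ω| ^ m + |V ω| ^ m)) μ :=
    (hUm.add hVm).const_mul _
  have hD : Integrable (fun ω => U ω * V ω - truncAt M (U ω) * truncAt M (V ω)) μ :=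
    hbound.mono' ((hU.mul hV).sub (hTU.mul hTV)).aestronglyMeasurable
      (Filter.Eventually.of_forall fun ω => abs_mul_sub_truncAt_mul_le hm hM _ _)
  have hUV : Integrable (fun ω => U ω * V ω) μ := 
    (hD.add hT).congr (Filter.Eventually.of_forall fun ω => sub_add_cancel _ _)
  rw [← integral_sub hUV hT, ← integral_add hUm hVm, ← integral_const_mul]
  exact (abs_integral_le_integral_abs).trans
    (integral_mono hD.abs hbound fun ω => abs_mul_sub_truncAt_mul_le hm hM _ _)

/-- Truncating both variables at level `M` changes their covariance by `O(M ^ (2 - m))`. -/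
lemma abs_cov_sub_cov_truncAt_le {Ω : Type*} [MeasurableSpace Ω] (P : Measure Ω)
    [IsProbabilityMeasure P] {U V : Ω → ℝ} (hU : Measurable U) (hV : Measurable V) {m M : ℝ}
    (hm : 2 ≤ m) (hM : 0 < M) (hUm : Integrable (fun ω => |U ω| ^ m) P)
    (hVm : Integrable (fun ω => |V ω| ^ m) P) :
    |((∫ ω, U ω * V ω ∂P) - (∫ ω, U ω ∂P) * ∫ ω, V ω ∂P)
        - ((∫ ω, truncAt M (U ω) * truncAt M (V ω) ∂P)
          - (∫ ω, truncAt M (U ω) ∂P) * ∫ ω, truncAt M (V ω) ∂P)|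
      ≤ 4 * M ^ (2 - m) * ((∫ ω, |U ω| ^ m ∂P) + ∫ ω, |V ω| ^ m ∂P) := by
  have hjoint := abs_integral_mul_sub_truncAt_le P hU hV hm hM hUm hVm
  -- The product of the means is the expectation of the product of independent copies.
  have hindep := abs_integral_mul_sub_truncAt_le (P.prod P) (hU.comp measurable_fst)
    (hV.comp measurable_snd) hm hM (hUm.comp_fst P) (hVm.comp_snd P)
  simp only [Function.comp_apply] at hindep
  rw [integral_prod_mul U V,
    integral_prod_mul (fun ω => truncAt M (U ω)) (fun ω => truncAt M (V ω)),
    integral_fun_fst (fun ω => |U ω| ^ m), integral_fun_snd (fun ω => |V ω| ^ m)] at hindep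
  simp only [probReal_univ, one_smul] at hindep
  rw [abs_le] at *
  constructor <;> linarith [hjoint.1, hjoint.2, hindep.1, hindep.2]

/-- A covariance bound for functions bounded by `1` rescales to truncations at level `M`. -/
lemma abs_cov_truncAt_le {Ω : Type*} [MeasurableSpace Ω] (P : Measure Ω) {U V : Ω → ℝ}
    {ε M : ℝ} (hM : 0 < M)
    (hcov : ∀ (g h : ℝ → ℝ) (L : ℝ), Measurable g → Measurable h →
      (∀ x, |g x| ≤ 1) → (∀ x, |h x| ≤ 1) → (∀ x y, |h x - h y| ≤ L * |x - y|) →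
      |(∫ ω, g (U ω) * h (V ω) ∂P) - (∫ ω, g (U ω) ∂P) * (∫ ω, h (V ω) ∂P)| ≤ L * ε) :
    |(∫ ω, truncAt M (U ω) * truncAt M (V ω) ∂P)
        - (∫ ω, truncAt M (U ω) ∂P) * ∫ ω, truncAt M (V ω) ∂P| ≤ M * ε := by
  have hmeas : Measurable fun x => M⁻¹ * truncAt M x := (measurable_truncAt M).const_mul _
  have hle : ∀ x, |M⁻¹ * truncAt M x| ≤ 1 := fun x => by
    rw [abs_mul, abs_of_pos (inv_pos.2 hM), inv_mul_le_iff₀ hM, mul_one]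
    exact abs_truncAt_le hM.le x
  have h := hcov _ _ M⁻¹ hmeas hmeas hle hle fun x y => by
    rw [← mul_sub, abs_mul, abs_of_pos (inv_pos.2 hM)]
    exact mul_le_mul_of_nonneg_left (abs_truncAt_sub_le M x y) (inv_pos.2 hM).le
  have hprod : ∀ ω, M⁻¹ * truncAt M (U ω) * (M⁻¹ * truncAt M (V ω))
      = M⁻¹ * M⁻¹ * (truncAt M (U ω) * truncAt M (V ω)) := fun ω => mul_mul_mul_comm _ _ _ _
  simp only [hprod, integral_const_mul] at h
  rw [mul_mul_mul_comm, ← mul_sub, abs_mul, abs_of_pos (by positivity), mul_assoc,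
    mul_le_mul_iff_right₀ (inv_pos.2 hM), inv_mul_le_iff₀ hM] at h
  exact h

/-- **Well-definedness of `σ²` in Theorem 4.1 under θ-weak dependence (pairwise case).**
For a stationary sequence with `E|X₀|^m < ∞`, `m > 2`, satisfying the pairwise θ-weak
dependence covariance inequality with coefficients `O(r^{−a})`, `a > 1 + 1/(m−2)`, the
series of covariances converges absolutely; in particular
`σ² = Σ_{t∈ℤ} cov(X₀, X_t)` is well defined as an absolutely convergent series. -/
theorem sigma_sq_well_defined_theta_weak_dependence
    {Ω : Type*} [MeasurableSpace Ω] (P : Measure Ω) [IsProbabilityMeasure P]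
    (X : ℤ → Ω → ℝ)
    (hmeas : ∀ t, Measurable (X t))
    (hstat : ∀ (k : ℕ) (t : Fin k → ℤ) (h : ℤ),
      IdentDistrib (fun ω (i : Fin k) => X (t i) ω)
        (fun ω (i : Fin k) => X (t i + h) ω) P P)
    (m : ℝ) (hm : 2 < m)
    (hmom : Integrable (fun ω => |X 0 ω| ^ m) P)
    (c a : ℝ) (hc : 0 ≤ c) (ha : 1 + 1 / (m - 2) < a)
    (hcov : ∀ r : ℕ, 1 ≤ r → ∀ (g h : ℝ → ℝ) (L : ℝ),
      Measurable g → Measurable h →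
      (∀ x, |g x| ≤ 1) → (∀ x, |h x| ≤ 1) →
      (∀ x y, |h x - h y| ≤ L * |x - y|) →
      |(∫ ω, g (X 0 ω) * h (X r ω) ∂P)
          - (∫ ω, g (X 0 ω) ∂P) * (∫ ω, h (X r ω) ∂P)|
        ≤ L * c * (r : ℝ) ^ (-a)) :
    Summable (fun t : ℕ =>
        |(∫ ω, X 0 ω * X ((t : ℤ) + 1) ω ∂P)
          - (∫ ω, X 0 ω ∂P) * (∫ ω, X ((t : ℤ) + 1) ω ∂P)|)
      ∧ Summable (fun t : ℤ =>
        |(∫ ω, X 0 ω * X t ω ∂P)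
          - (∫ ω, X 0 ω ∂P) * (∫ ω, X t ω ∂P)|) := by
  have hident : ∀ t : ℤ, IdentDistrib (X 0) (X t) P P := fun t => by
    simpa [Function.comp_def] using
      (hstat 1 (fun _ => 0) t).comp (measurable_pi_apply (0 : Fin 1))
  have hpow : Measurable fun x : ℝ => |x| ^ m := by fun_prop
  have hident_pow : ∀ t : ℤ,
      IdentDistrib (fun ω => |X 0 ω| ^ m) (fun ω => |X t ω| ^ m) P P :=
    fun t => (hident t).comp hpow
  set K := ∫ ω, |X 0 ω| ^ m ∂P
  obtain ⟨b, hb, hba⟩ : ∃ b, 1 / (m - 2) < b ∧ b < a - 1 := exists_between (by linarith)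
  have hbm : 1 < b * (m - 2) := (div_lt_iff₀ (by linarith)).1 hb
  have hbound : ∀ r : ℕ, 1 ≤ r →
      |(∫ ω, X 0 ω * X r ω ∂P) - (∫ ω, X 0 ω ∂P) * ∫ ω, X r ω ∂P|
        ≤ c * (r : ℝ) ^ (b - a) + 8 * K * (r : ℝ) ^ (b * (2 - m)) := fun r hr => by
    have hr0 : (0 : ℝ) < r := by exact_mod_cast hr
    have hM : 0 < (r : ℝ) ^ b := by positivity
    have htrunc := abs_cov_truncAt_le P (U := X 0) (V := X r) (ε := c * (r : ℝ) ^ (-a)) hM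
      fun g h L hg hh hg1 hh1 hL => by
        simpa only [mul_assoc] using hcov r hr g h L hg hh hg1 hh1 hL
    have herr := abs_cov_sub_cov_truncAt_le P (hmeas 0) (hmeas r) hm.le hM hmom
      ((hident_pow r).integrable_iff.1 hmom)
    rw [← (hident_pow r).integral_eq, ← Real.rpow_mul hr0.le] at herr
    have hexp : (r : ℝ) ^ b * (c * (r : ℝ) ^ (-a)) = c * (r : ℝ) ^ (b - a) := by
      rw [sub_eq_add_neg, Real.rpow_add hr0]
      ring
    rw [hexp] at htrunc
    rw [abs_le] at *
    constructor <;> linarith [htrunc.1, htrunc.2, herr.1, herr.2]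
  have hsummable_bound : Summable fun r : ℕ =>
      c * (r : ℝ) ^ (b - a) + 8 * K * (r : ℝ) ^ (b * (2 - m)) :=
    ((Real.summable_nat_rpow.2 (by linarith)).mul_left _).add
      ((Real.summable_nat_rpow.2 (by linarith)).mul_left _)
  have hsummable_succ : Summable (fun t : ℕ =>
      |(∫ ω, X 0 ω * X ((t : ℤ) + 1) ω ∂P)
        - (∫ ω, X 0 ω ∂P) * (∫ ω, X ((t : ℤ) + 1) ω ∂P)|) := by
    refine Summable.of_nonneg_of_le (fun _ => abs_nonneg _) (fun t => ?_)
      ((summable_nat_add_iff 1).2 hsummable_bound)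
    simpa only [Nat.cast_add, Nat.cast_one] using hbound (t + 1) (by lia)
  have hsummable_nat : Summable fun t : ℕ =>
      |(∫ ω, X 0 ω * X t ω ∂P) - (∫ ω, X 0 ω ∂P) * ∫ ω, X t ω ∂P| := by
    rw [← summable_nat_add_iff 1]
    simpa only [Nat.cast_add, Nat.cast_one] using hsummable_succ
  refine ⟨hsummable_succ, Summable.of_nat_of_neg hsummable_nat (hsummable_nat.congr fun t => ?_)⟩
  have hshift : ∫ ω, X 0 ω * X (-(t : ℤ)) ω ∂P = ∫ ω, X 0 ω * X t ω ∂P := by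
    have hmul : Measurable fun p : Fin 2 → ℝ => p 0 * p 1 := by fun_prop
    have h := ((hstat 2 ![0, -(t : ℤ)] t).comp hmul).integral_eq
    simpa [mul_comm] using h
  rw [hshift, ← (hident (-(t : ℤ))).integral_eq, ← (hident t).integral_eq]
end
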